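/- Let F/K be a finite Galois extension of number fields with Galois group G, let d be the degree of K over ℚ, let S∞ be the set of archimedean places of F, and let μ_F be the group of roots of unity of F. Then the equality [Ãr_F] − [Ar_F] = d·[ℤ[G]] − [ℤ[S∞]] + σ[μ_F] holds in G₀(ℤ[G]). -/

import Mathlib

/-- A bundled finitely generated module over a ring `R`. -/
structure FGMod (R : Type) [Ring R] : Type 1 where
  carrier : Type
  [isAddCommGroup : AddCommGroup carrier]
  [isModule : Module R carrier]
  [isFinite : Module.Finite R carrier]

attribute [instance] FGMod.isAddCommGroup FGMod.isModule FGMod.isFinite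

/-- The subgroup of relations defining the Grothendieck group `G₀(R)`:
one relation `[M] = [L] + [N]` for each short exact sequence `0 → L → M → N → 0`
of finitely generated `R`-modules. -/
def G0Rel (R : Type) [Ring R] : AddSubgroup (FreeAbelianGroup (FGMod R)) :=
  AddSubgroup.closure
    { x | ∃ (L M N : FGMod R) (f : L.carrier →ₗ[R] M.carrier)
            (g : M.carrier →ₗ[R] N.carrier),
        Function.Injective f ∧ Function.Surjective g ∧ Function.Exact f g ∧
        x = FreeAbelianGroup.of M - FreeAbelianGroup.of L - FreeAbelianGroup.of N }

/-- The Grothendieck group `G₀(R)` of the category of finitely generated `R`-modules. -/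
def G0 (R : Type) [Ring R] : Type 1 :=
  FreeAbelianGroup (FGMod R) ⧸ G0Rel R

instance (R : Type) [Ring R] : AddCommGroup (G0 R) :=
  QuotientAddGroup.Quotient.addCommGroup _

/-- The class `[M] ∈ G₀(R)` of a finitely generated `R`-module `M` (junk value `0` if `M` is
not finitely generated). -/
noncomputable def G0.cls (R : Type) [Ring R] (M : Type) [AddCommGroup M] [Module R M] :
    G0 R := by
  classical
  exact
    if h : Module.Finite R M then
      QuotientAddGroup.mk (FreeAbelianGroup.of (@FGMod.mk R _ M _ _ h))
    else 0

open NumberField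
open scoped nonZeroDivisors TensorProduct

noncomputable section

variable (F : Type) [Field F] [NumberField F]

/-- The étale ℝ-algebra F_ℝ = F ⊗_ℚ ℝ. -/
abbrev FReal := ℝ ⊗[ℚ] F

/-- The canonical (finite-dimensional real vector space) topology on F_ℝ. -/
instance : TopologicalSpace (FReal F) :=
  TopologicalSpace.induced (Module.finBasis ℝ (FReal F)).equivFun inferInstance

/-- The group of fractional ideals of F. -/
abbrev IdealGroup := (FractionalIdeal (𝓞 F)⁰ F)ˣ

/-- The group of fractional ideals carries the discrete topology. -/
instance : TopologicalSpace (IdealGroup F) := ⊥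

/-- The ideal norm, as a group homomorphism to ℝˣ. -/
def idealNormHom : IdealGroup F →* ℝˣ :=
  (Units.map (Rat.castHom ℝ).toMonoidHom).comp
    (Units.map (FractionalIdeal.absNorm (R := 𝓞 F) (K := F)).toMonoidHom)

/-- The absolute value of the algebra norm on F_ℝˣ, as a group homomorphism to ℝˣ. -/
def absNormFR : (FReal F)ˣ →* ℝˣ :=
  (Units.map (absHom (α := ℝ)).toMonoidHom).comp (Units.map (Algebra.norm ℝ (S := FReal F)))

/-- The fibre product Id_F ×_{ℝ>0} F_ℝˣ, i.e. the subgroup of pairs (I, b) with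
N(I) = |Nm(b)|, formalized as the kernel of the quotient of the two norm maps. -/
def picDom : Subgroup (IdealGroup F × (FReal F)ˣ) :=
  MonoidHom.ker (((idealNormHom F).comp (MonoidHom.fst _ _)) /
    ((absNormFR F).comp (MonoidHom.snd _ _)))

/-- The map F^× → Id_F ×_{ℝ>0} F_ℝˣ, α ↦ (αO_F, α ⊗ 1). -/
def principalHom : Fˣ →* IdealGroup F × (FReal F)ˣ :=
  (toPrincipalIdeal (𝓞 F) F).prod
    (Units.map (Algebra.TensorProduct.includeRight : F →ₐ[ℚ] FReal F).toMonoidHom)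

/-- The subgroup of the fibre product coming from principal oriented Arakelov divisors. -/
def principalSub : Subgroup (picDom F) :=
  Subgroup.comap (picDom F).subtype (MonoidHom.range (principalHom F))

/-- The oriented Arakelov class group of F: the cokernel of F^× → Id_F ×_{ℝ>0} F_ℝˣ. -/
def PicTilde := picDom F ⧸ principalSub F

instance : CommGroup (PicTilde F) := QuotientGroup.Quotient.commGroup _
instance : TopologicalSpace (PicTilde F) := instTopologicalSpaceQuotient

/-- The class of an oriented Arakelov divisor in the oriented Arakelov class group. -/
def PicTilde.mk : picDom F → PicTilde F := QuotientGroup.mk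

/-- The maximal compact subgroup comp(F_ℝˣ) of F_ℝˣ: the subgroup generated by all
compact subgroups. -/
def maxCompact : Subgroup (FReal F)ˣ :=
  sSup { H : Subgroup (FReal F)ˣ | IsCompact (H : Set (FReal F)ˣ) }

/-- The image of {1} × comp(F_ℝˣ) in the oriented Arakelov class group. -/
def compImage : Subgroup (PicTilde F) :=
  Subgroup.map (QuotientGroup.mk' (principalSub F))
    (Subgroup.comap (picDom F).subtype ((⊥ : Subgroup (IdealGroup F)).prod (maxCompact F)))

/-- The Arakelov class group of F: the quotient of the oriented Arakelov class group by
the image of {1} × comp(F_ℝˣ). -/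
def PicZero := PicTilde F ⧸ compImage F

instance : CommGroup (PicZero F) := QuotientGroup.Quotient.commGroup _
instance : TopologicalSpace (PicZero F) := instTopologicalSpaceQuotient

/-- The class of an oriented Arakelov divisor in the Arakelov class group. -/
def PicZero.mk : picDom F → PicZero F := fun x => QuotientGroup.mk (PicTilde.mk F x)

/-- ℝ/ℤ. -/
abbrev RmodZ := AddCircle (1 : ℝ)

/-- The Pontryagin dual Ãr_F of the oriented Arakelov class group: the group of
continuous homomorphisms to ℝ/ℤ. -/
def ArTilde := ContinuousAddMonoidHom (Additive (PicTilde F)) RmodZ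

instance : AddCommGroup (ArTilde F) := by unfold ArTilde; infer_instance
instance : FunLike (ArTilde F) (Additive (PicTilde F)) RmodZ := by unfold ArTilde; infer_instance

/-- The Pontryagin dual Ar_F of the Arakelov class group. -/
def ArF := ContinuousAddMonoidHom (Additive (PicZero F)) RmodZ

instance : AddCommGroup (ArF F) := by unfold ArF; infer_instance
instance : FunLike (ArF F) (Additive (PicZero F)) RmodZ := by unfold ArF; infer_instance

/-- ℚ/ℤ as a ℤ-module. -/
abbrev QmodZ := ℚ ⧸ (Submodule.span ℤ {(1 : ℚ)})

variable {F} in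
/-- The automorphism of F_ℝ = ℝ ⊗_ℚ F induced by an automorphism of F over a subfield K. -/
def galFReal (K : Type) [Field K] [CharZero K] [Algebra K F] (g : F ≃ₐ[K] F) : FReal F ≃ₐ[ℚ] FReal F :=
  Algebra.TensorProduct.congr AlgEquiv.refl (g.restrictScalars ℚ)

end

namespace G0

variable {R : Type} [Ring R]

/-- The quotient map onto `G₀(R)`. -/
def mkHom (R : Type) [Ring R] : FreeAbelianGroup (FGMod R) →+ G0 R :=
  QuotientAddGroup.mk' (G0Rel R)

theorem cls_of_finite (M : Type) [AddCommGroup M] [Module R M] [h : Module.Finite R M] :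
    cls R M = mkHom R (FreeAbelianGroup.of (FGMod.mk M)) :=
  dif_pos h

theorem cls_of_not_finite (M : Type) [AddCommGroup M] [Module R M] (h : ¬ Module.Finite R M) :
    cls R M = 0 :=
  dif_neg h

theorem cls_eq_add {L M N : Type} [AddCommGroup L] [Module R L] [AddCommGroup M] [Module R M]
    [AddCommGroup N] [Module R N] [Module.Finite R L] [Module.Finite R M] [Module.Finite R N]
    (f : L →ₗ[R] M) (g : M →ₗ[R] N) (hf : Function.Injective f) (hg : Function.Surjective g)
    (hfg : Function.Exact f g) : cls R M = cls R L + cls R N := by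
  rw [cls_of_finite, cls_of_finite, cls_of_finite, ← sub_eq_zero, ← sub_sub, ← map_sub, ← map_sub]
  refine (QuotientAddGroup.eq_zero_iff (N := G0Rel R) _).mpr (AddSubgroup.subset_closure ?_)
  exact ⟨FGMod.mk L, FGMod.mk M, FGMod.mk N, f, g, hf, hg, hfg, rfl⟩

theorem cls_eq_zero (M : Type) [AddCommGroup M] [Module R M] [Subsingleton M] :
    cls R M = 0 := by
  have h := cls_eq_add (R := R) (LinearMap.id : M →ₗ[R] M) (LinearMap.id : M →ₗ[R] M)
    (fun _ _ h => h) (fun x => ⟨x, rfl⟩)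
    (fun x => ⟨fun _ => ⟨x, rfl⟩, fun _ => Subsingleton.elim _ _⟩)
  simpa using h

theorem cls_congr {M N : Type} [AddCommGroup M] [Module R M] [AddCommGroup N] [Module R N]
    (e : M ≃ₗ[R] N) : cls R M = cls R N := by
  by_cases h : Module.Finite R M
  · have : Module.Finite R N := Module.Finite.equiv e
    have h := cls_eq_add (R := R) (0 : PUnit →ₗ[R] M) e.toLinearMap
      (fun _ _ _ => Subsingleton.elim _ _) e.surjective
      (fun x => ⟨fun h => ⟨0, ((map_eq_zero_iff e e.injective).mp h).symm⟩, by rintro ⟨y, rfl⟩; simp⟩)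
    rw [h, cls_eq_zero PUnit, zero_add]
  · have h' : ¬ Module.Finite R N := fun h' => h (Module.Finite.equiv e.symm)
    rw [cls_of_not_finite M h, cls_of_not_finite N h']

theorem cls_eq_ker_add_range [IsNoetherianRing R] {M N : Type} [AddCommGroup M] [Module R M]
    [AddCommGroup N] [Module R N] [Module.Finite R M] (f : M →ₗ[R] N) :
    cls R M = cls R f.ker + cls R f.range :=
  cls_eq_add f.ker.subtype f.rangeRestrict f.ker.injective_subtype f.surjective_rangeRestrict
    (by rw [LinearMap.exact_iff]; simp)

theorem cls_fin_fun (M : Type) [AddCommGroup M] [Module R M] [Module.Finite R M] (n : ℕ) :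
    cls R (Fin n → M) = n • cls R M := by
  induction n with
  | zero => rw [zero_smul, cls_eq_zero]
  | succ k ih =>
    rw [← cls_congr (Fin.consLinearEquiv R (fun _ : Fin (k + 1) => M)),
      cls_eq_add (LinearMap.inl R M (Fin k → M)) (LinearMap.snd R M (Fin k → M))
        LinearMap.inl_injective LinearMap.snd_surjective .inl_snd, ih, succ_nsmul']

theorem cls_fun (ι M : Type) [Fintype ι] [AddCommGroup M] [Module R M] [Module.Finite R M] :
    cls R (ι → M) = Fintype.card ι • cls R M := by
  rw [cls_congr (LinearEquiv.funCongrLeft R M (Fintype.equivFin ι).symm), cls_fin_fun]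

/-- The relation in `G₀(R)` coming from a pair of exact sequences `0 → A → T → D`,
`0 → S → P → D` in which the image of `T` is the kernel of a map on the image of `P`. -/
theorem cls_sub_cls_of_exact [IsNoetherianRing R] {A T S P D M Q : Type}
    [AddCommGroup A] [Module R A] [AddCommGroup T] [Module R T] [AddCommGroup S] [Module R S]
    [AddCommGroup P] [Module R P] [AddCommGroup D] [Module R D] [AddCommGroup M] [Module R M]
    [AddCommGroup Q] [Module R Q] [Module.Finite R A] [Module.Finite R P]
    (i : A →ₗ[R] T) (a : T →ₗ[R] D) (j : S →ₗ[R] P) (p : P →ₗ[R] D) (q : D →ₗ[R] M)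
    (e : Q →ₗ[R] M) (hi : Function.Injective i) (hia : Function.Exact i a)
    (hj : Function.Injective j) (hjp : Function.Exact j p) (hap : ∀ t, ∃ x, p x = a t)
    (hqa : ∀ t, q (a t) = 0) (hqp : ∀ x, q (p x) = 0 → ∃ t, a t = p x)
    (he : Function.Injective e) (hpe : ∀ x, ∃ y, e y = q (p x)) (hep : ∀ y, ∃ x, q (p x) = e y) :
    cls R T - cls R A = cls R P - cls R S - cls R Q := by
  have hra : a.range ≤ p.range := by
    rintro _ ⟨t, rfl⟩
    exact hap t
  have : Module.Finite R a.range := Module.Finite.of_injective (Submodule.inclusion hra)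
    (Submodule.inclusion_injective hra)
  have hker : a.ker = i.range := (LinearMap.exact_iff.mp hia)
  have hkerp : p.ker = j.range := (LinearMap.exact_iff.mp hjp)
  have : Module.Finite R a.ker := by
    rw [hker]
    infer_instance
  have : Module.Finite R T := by
    have h1 : Module.Finite R (T ⧸ a.ker) := Module.Finite.equiv a.quotKerEquivRange.symm
    exact Module.Finite.of_submodule_quotient a.ker
  have hT := cls_eq_ker_add_range a
  have hP := cls_eq_ker_add_range p
  have hkA : cls R a.ker = cls R A := by
    rw [hker]
    exact (cls_congr (LinearEquiv.ofInjective i hi)).symm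
  have hkS : cls R p.ker = cls R S := by
    rw [hkerp]
    exact (cls_congr (LinearEquiv.ofInjective j hj)).symm
  have hQ := cls_eq_ker_add_range (q.domRestrict p.range)
  have h1 : (q.domRestrict p.range).range = e.range := by
    ext m
    constructor
    · rintro ⟨⟨_, x, rfl⟩, rfl⟩
      exact hpe x
    · rintro ⟨y, rfl⟩
      obtain ⟨x, hx⟩ := hep y
      exact ⟨⟨p x, x, rfl⟩, hx⟩
  have h2 : (q.domRestrict p.range).ker = (Submodule.inclusion hra).range := by
    ext ⟨d, x, rfl⟩
    constructor
    · intro h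
      obtain ⟨t, ht⟩ := hqp x h
      exact ⟨⟨a t, t, rfl⟩, Subtype.ext ht⟩
    · rintro ⟨⟨_, t, rfl⟩, h⟩
      have h' : a t = p x := congrArg Subtype.val h
      change q (p x) = 0
      rw [← h', hqa]
  rw [h1, h2, ← cls_congr (LinearEquiv.ofInjective e he),
    ← cls_congr (LinearEquiv.ofInjective _ (Submodule.inclusion_injective hra))] at hQ
  rw [hT, hP, hkA, hkS, hQ]
  abel

end G0

section GroupRing

variable {G : Type} [Group G]

/-- An additive map commuting with the group elements is linear over the group ring. -/
def groupRingLinearMap {M N : Type} [AddCommGroup M] [AddCommGroup N]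
    [Module (MonoidAlgebra ℤ G) M] [Module (MonoidAlgebra ℤ G) N] (f : M →+ N)
    (h : ∀ (g : G) (x : M), f ((MonoidAlgebra.single g (1 : ℤ) : MonoidAlgebra ℤ G) • x) =
      (MonoidAlgebra.single g (1 : ℤ) : MonoidAlgebra ℤ G) • f x) :
    M →ₗ[MonoidAlgebra ℤ G] N where
  __ := f
  map_smul' r x := by
    change f (r • x) = r • f x
    induction r using MonoidAlgebra.induction_on with
    | of g => exact h g x
    | add r s hr hs => rw [add_smul, map_add, hr, hs, add_smul]
    | smul n r hr => rw [smul_assoc, map_zsmul, hr, smul_assoc]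

/-- An additive action of `G` extends to the group ring. -/
theorem exists_groupRing_module {M : Type} [AddCommGroup M] (ρ : G →* AddMonoid.End M) :
    ∃ _ : Module (MonoidAlgebra ℤ G) M, ∀ (g : G) (x : M),
      (MonoidAlgebra.single g (1 : ℤ) : MonoidAlgebra ℤ G) • x = ρ g x := by
  let φ : MonoidAlgebra ℤ G →+* AddMonoid.End M :=
    (MonoidAlgebra.lift ℤ (AddMonoid.End M) G ρ).toRingHom
  refine ⟨Module.compHom M φ, fun g x => ?_⟩
  change (MonoidAlgebra.lift ℤ (AddMonoid.End M) G ρ) (MonoidAlgebra.single g 1) x = _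
  simp

/-- Functions on a `G`-set form a module over the group ring. -/
theorem exists_groupRing_module_fun (X A : Type) [MulAction G X] [AddCommGroup A] :
    ∃ _ : Module (MonoidAlgebra ℤ G) (X → A), ∀ (g : G) (f : X → A) (x : X),
      ((MonoidAlgebra.single g (1 : ℤ) : MonoidAlgebra ℤ G) • f) x = f (g⁻¹ • x) := by
  let ρ : G →* AddMonoid.End (X → A) :=
    { toFun := fun g =>
        { toFun := fun f x => f (g⁻¹ • x)
          map_zero' := rfl
          map_add' := fun _ _ => rfl }
      map_one' := by
        ext f x
        change f (1⁻¹ • x) = f x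
        rw [inv_one, one_smul]
      map_mul' := fun g h => by
        ext f x
        change f ((g * h)⁻¹ • x) = f (h⁻¹ • g⁻¹ • x)
        rw [mul_inv_rev, mul_smul] }
  obtain ⟨m, hm⟩ := exists_groupRing_module ρ
  exact ⟨m, fun g f x => congrFun (hm g f) x⟩

/-- The additive functions on an abelian group with additive `G`-action, with values in an
abelian group, form a module over the group ring. -/
theorem exists_groupRing_module_hom (N Q : Type) [AddCommGroup N] [AddCommGroup Q] [Module ℤ Q]
    [Module (MonoidAlgebra ℤ G) N] :
    ∃ _ : Module (MonoidAlgebra ℤ G) (N →ₗ[ℤ] Q), ∀ (g : G) (f : N →ₗ[ℤ] Q) (x : N),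
      ((MonoidAlgebra.single g (1 : ℤ) : MonoidAlgebra ℤ G) • f) x =
        f ((MonoidAlgebra.single g⁻¹ (1 : ℤ) : MonoidAlgebra ℤ G) • x) := by
  let s : G → N →ₗ[ℤ] N := fun g =>
    { toFun := fun x => (MonoidAlgebra.single g (1 : ℤ) : MonoidAlgebra ℤ G) • x
      map_add' := smul_add _
      map_smul' := fun n x => (smul_comm n _ x).symm }
  let ρ : G →* AddMonoid.End (N →ₗ[ℤ] Q) :=
    { toFun := fun g =>
        { toFun := fun f => f.comp (s g⁻¹)
          map_zero' := LinearMap.zero_comp _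
          map_add' := fun _ _ => LinearMap.add_comp _ _ _ }
      map_one' := by
        ext f x
        change f ((MonoidAlgebra.single 1⁻¹ (1 : ℤ) : MonoidAlgebra ℤ G) • x) = f x
        rw [inv_one, ← MonoidAlgebra.one_def, one_smul]
      map_mul' := fun g h => by
        ext f x
        change f ((MonoidAlgebra.single (g * h)⁻¹ (1 : ℤ) : MonoidAlgebra ℤ G) • x) =
          f ((MonoidAlgebra.single h⁻¹ (1 : ℤ) : MonoidAlgebra ℤ G) •
            (MonoidAlgebra.single g⁻¹ (1 : ℤ) : MonoidAlgebra ℤ G) • x)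
        rw [smul_smul, MonoidAlgebra.single_mul_single, mul_inv_rev, mul_one] }
  obtain ⟨m, hm⟩ := exists_groupRing_module ρ
  exact ⟨m, fun g f x => congrArg (fun f : N →ₗ[ℤ] Q => f x) (hm g f)⟩

end GroupRing

section Circle

open Complex

/-- Continuous homomorphisms from the real line to the circle lift to the real line. -/
theorem exists_real_lift (f : ℝ → RmodZ) (hf : Continuous f)
    (hadd : ∀ s t, f (s + t) = f s + f t) : ∃ c : ℝ, ∀ t, f t = ((t * c : ℝ) : RmodZ) := by
  have h0 : f 0 = 0 := by simpa using hadd 0 0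
  have cov := AddCircle.isCoveringMap_coe (𝕜 := ℝ) 1
  obtain ⟨F, ⟨hF0, hF⟩, -⟩ := cov.existsUnique_continuousMap_lifts ⟨f, hf⟩ 0 0 (by simp [h0])
  have hF' : ∀ t, ((F t : ℝ) : RmodZ) = f t := fun t => congrFun hF t
  have hFadd : ∀ s t, F (s + t) = F s + F t := by
    have h : (fun x : ℝ × ℝ => F (x.1 + x.2)) = fun x : ℝ × ℝ => F x.1 + F x.2 := by
      refine cov.eq_of_comp_eq (by fun_prop) (by fun_prop) ?_ (0, 0) (by simp [hF0])
      ext x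
      simp [hF', hadd]
    exact fun s t => congrFun h (s, t)
  let L := (AddMonoidHom.mk' F hFadd).toRealLinearMap F.continuous
  refine ⟨F 1, fun t => ?_⟩
  have h : L (t • 1) = t • L 1 := map_smul L t 1
  rw [smul_eq_mul, mul_one, smul_eq_mul] at h
  rw [← hF']
  exact congrArg _ h

/-- Continuous homomorphisms from the real line to the circle that kill `1` are multiples of
the projection. -/
theorem exists_int_lift (f : ℝ → RmodZ) (hf : Continuous f)
    (hadd : ∀ s t, f (s + t) = f s + f t) (h1 : f 1 = 0) :
    ∃ n : ℤ, ∀ t, f t = n • ((t : ℝ) : RmodZ) := by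
  obtain ⟨c, hc⟩ := exists_real_lift f hf hadd
  rw [hc, one_mul, AddCircle.coe_eq_zero_iff] at h1
  obtain ⟨n, hn⟩ := h1
  refine ⟨n, fun t => ?_⟩
  rw [hc, ← hn, ← AddCircle.coe_zsmul]
  congr 1
  simp [mul_comm]

/-- The argument of a complex number, normalised to lie in `ℝ/ℤ`. -/
noncomputable def argC (z : ℂ) : RmodZ := ((arg z / (2 * Real.pi) : ℝ) : RmodZ)

theorem argC_eq (z : ℂ) : argC z = AddCircle.homeomorphAddCircle (2 * Real.pi) 1
    Real.two_pi_pos.ne' one_ne_zero ((arg z : Real.Angle) : AddCircle (2 * Real.pi)) := by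
  rw [argC]
  change _ = AddCircle.homeomorphAddCircle (2 * Real.pi) 1
    Real.two_pi_pos.ne' one_ne_zero ((arg z : ℝ) : AddCircle (2 * Real.pi))
  rw [AddCircle.homeomorphAddCircle_apply_mk, mul_one, div_eq_mul_inv]

theorem argC_eq' (z : ℂ) : argC z = AddCircle.equivAddCircle (2 * Real.pi) 1
    Real.two_pi_pos.ne' one_ne_zero ((arg z : Real.Angle) : AddCircle (2 * Real.pi)) :=
  argC_eq z

theorem argC_mul {z w : ℂ} (hz : z ≠ 0) (hw : w ≠ 0) : argC (z * w) = argC z + argC w := by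
  rw [argC_eq', argC_eq', argC_eq', arg_mul_coe_angle hz hw]
  exact map_add _ _ _

@[simp]
theorem argC_one : argC 1 = 0 := by simp [argC]

theorem argC_conj (z : ℂ) : argC (starRingEnd ℂ z) = - argC z := by
  rw [argC_eq', argC_eq', arg_conj_coe_angle]
  exact map_neg _ _

theorem continuousAt_argC {z : ℂ} (hz : z ≠ 0) : ContinuousAt argC z := by
  have h : argC = (AddCircle.homeomorphAddCircle (2 * Real.pi) 1
    Real.two_pi_pos.ne' one_ne_zero) ∘ ((↑) ∘ arg : ℂ → Real.Angle) := funext argC_eq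
  rw [h]
  exact (Homeomorph.continuous _).continuousAt.comp (continuousAt_arg_coe_angle hz)

theorem argC_inj {z w : ℂ} (hz : ‖z‖ = 1) (hw : ‖w‖ = 1) (h : argC z = argC w) : z = w := by
  rw [argC_eq', argC_eq'] at h
  have h' : (arg z : Real.Angle) = (arg w : Real.Angle) := (AddCircle.equivAddCircle _ _ _ _).injective h
  refine ext_norm_arg (hz.trans hw.symm) ?_
  exact arg_coe_angle_eq_iff.mp h'

theorem argC_exp (t : ℝ) : argC (exp (2 * Real.pi * t * I)) = (t : RmodZ) := by
  have h : (arg (exp (2 * Real.pi * t * I)) : Real.Angle) = ((2 * Real.pi * t : ℝ) : Real.Angle) := by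
    have := Real.Angle.arg_toCircle ((2 * Real.pi * t : ℝ) : Real.Angle)
    rw [Real.Angle.toCircle_coe, Circle.coe_exp] at this
    simpa using this
  rw [argC_eq', h]
  change AddCircle.equivAddCircle (2 * Real.pi) 1 Real.two_pi_pos.ne' one_ne_zero
    ((2 * Real.pi * t : ℝ) : AddCircle (2 * Real.pi)) = _
  rw [AddCircle.equivAddCircle_apply_mk]
  congr 1
  field_simp

theorem argC_neg_one_ne_zero : argC (-1) ≠ 0 := by
  intro h
  have := argC_inj (z := -1) (w := 1) (by simp) (by simp) (by rw [h, argC_one])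
  norm_num at this

theorem two_smul_argC_neg_one : (2 : ℤ) • argC (-1) = 0 := by
  rw [two_smul, ← argC_mul (by simp) (by simp)]
  simp

theorem exists_norm_eq_one_argC_eq (x : RmodZ) : ∃ z : ℂ, ‖z‖ = 1 ∧ argC z = x := by
  obtain ⟨t, rfl⟩ := QuotientAddGroup.mk_surjective x
  refine ⟨exp (2 * Real.pi * t * I), ?_, argC_exp t⟩
  exact_mod_cast norm_exp_ofReal_mul_I (2 * Real.pi * t)

theorem eq_zero_of_forall_zsmul_eq_zero {n : ℤ} (h : ∀ x : RmodZ, n • x = 0) : n = 0 := by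
  by_contra hn
  have h2 := h ((1 / (2 * n) : ℝ) : RmodZ)
  rw [← AddCircle.coe_zsmul, AddCircle.coe_eq_zero_iff] at h2
  obtain ⟨m, hm⟩ := h2
  have hn' : (n : ℝ) ≠ 0 := by exact_mod_cast hn
  simp only [zsmul_eq_mul, mul_one] at hm
  have h3 : (2 * m : ℝ) = 1 := by
    rw [hm]
    field_simp
  have h4 : (2 * m : ℤ) = 1 := by exact_mod_cast h3
  omega

theorem zsmul_argC_neg_one_eq_zero_iff {n : ℤ} : n • argC (-1) = 0 ↔ Even n := by
  constructor
  · intro h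
    by_contra hn
    obtain ⟨k, rfl⟩ := Int.not_even_iff_odd.mp hn
    rw [add_smul, mul_comm, mul_smul, two_smul_argC_neg_one] at h
    simp [argC_neg_one_ne_zero] at h
  · rintro ⟨k, rfl⟩
    rw [← two_mul, mul_comm, mul_smul, two_smul_argC_neg_one, smul_zero]

theorem exists_zsmul_argC_neg_one {x : RmodZ} (h : x + x = 0) : ∃ n : ℤ, x = n • argC (-1) := by
  obtain ⟨z, hz, rfl⟩ := exists_norm_eq_one_argC_eq x
  have hz0 : z ≠ 0 := by
    rintro rfl
    simp at hz
  rw [← argC_mul hz0 hz0] at h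
  have h1 : z * z = 1 := argC_inj (by simp [hz]) (by simp) (by rw [h, argC_one])
  rcases mul_self_eq_one_iff.mp h1 with rfl | rfl
  · exact ⟨0, by simp⟩
  · exact ⟨1, by simp⟩

end Circle

section Evaluation

open ComplexEmbedding InfinitePlace

variable {F : Type} [Field F]

section

variable [NumberField F]

/-- The `ℝ`-algebra homomorphism `F_ℝ → ℂ` induced by a complex embedding of `F`. -/
noncomputable def evC (τ : F →+* ℂ) : FReal F →ₐ[ℝ] ℂ :=
  Algebra.TensorProduct.lift (Algebra.ofId ℝ ℂ) (RingHom.equivRatAlgHom F ℂ τ)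
    (fun _ _ => Commute.all _ _)

@[simp]
theorem evC_tmul (τ : F →+* ℂ) (r : ℝ) (x : F) : evC τ (r ⊗ₜ x) = r * τ x := by
  simp [evC, Algebra.ofId_apply]

theorem evC_conjugate (τ : F →+* ℂ) (b : FReal F) :
    evC (conjugate τ) b = starRingEnd ℂ (evC τ b) := by
  induction b using TensorProduct.induction_on with
  | zero => simp
  | tmul r x => simp [conjugate_coe_eq]
  | add x y hx hy => simp [hx, hy]

theorem evC_galFReal {K : Type} [Field K] [NumberField K] [Algebra K F] (g : F ≃ₐ[K] F)
    (τ : F →+* ℂ) (b : FReal F) :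
    evC τ (galFReal K g b) = evC (τ.comp (g : F →+* F)) b := by
  induction b using TensorProduct.induction_on with
  | zero => simp
  | tmul r x => simp [galFReal]
  | add x y hx hy => simp [hx, hy]

theorem evC_eq_of_isReal {τ : F →+* ℂ} (hτ : ComplexEmbedding.IsReal τ) (b : FReal F) :
    starRingEnd ℂ (evC τ b) = evC τ b := by
  rw [← evC_conjugate, isReal_iff.mp hτ]

theorem exists_basis_matrix (F : Type) [Field F] [NumberField F] :
    ∃ (ι : Type) (_ : Fintype ι) (_ : DecidableEq ι) (B : Module.Basis ι ℝ (FReal F))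
      (e : ι ≃ (F →+* ℂ)), (Matrix.of fun i j => evC (e j) (B i)).det ≠ 0 := by
  classical
  let b := Module.finBasis ℚ F
  let e : Fin (Module.finrank ℚ F) ≃ (F →ₐ[ℚ] ℂ) :=
    Fintype.equivOfCardEq (by rw [Fintype.card_fin, AlgHom.card])
  refine ⟨_, inferInstance, inferInstance, Algebra.TensorProduct.basis ℝ b,
    e.trans (RingHom.equivRatAlgHom F ℂ).symm, ?_⟩
  have h := Algebra.discr_eq_det_embeddingsMatrixReindex_pow_two ℚ ℂ b e
  have h' : (Matrix.of fun i j => evC ((e.trans (RingHom.equivRatAlgHom F ℂ).symm) j)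
      (Algebra.TensorProduct.basis ℝ b i)) = Algebra.embeddingsMatrixReindex ℚ ℂ b e := by
    ext i j
    simp [Algebra.embeddingsMatrixReindex]
  rw [h']
  intro h0
  rw [h0, zero_pow two_ne_zero, map_eq_zero] at h
  exact Algebra.discr_not_zero_of_basis ℚ b h

theorem norm_eq_prod_evC (x : FReal F) : ((Algebra.norm ℝ x : ℝ) : ℂ) = ∏ τ : F →+* ℂ, evC τ x := by
  obtain ⟨ι, _, _, B, e, hM⟩ := exists_basis_matrix F
  set M : Matrix ι ι ℂ := Matrix.of fun i j => evC (e j) (B i) with hMdef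
  set A := (Algebra.leftMulMatrix B x).map (algebraMap ℝ ℂ) with hA
  have h : A.transpose * M = M * Matrix.diagonal (fun j => evC (e j) x) := by
    ext i j
    rw [Matrix.mul_diagonal, Matrix.mul_apply]
    simp only [hA, hMdef, Matrix.transpose_apply, Matrix.map_apply, Matrix.of_apply,
      Algebra.leftMulMatrix_eq_repr_mul]
    rw [← map_mul, mul_comm (B i) x]
    conv_rhs => rw [← B.sum_repr (x * B i), map_sum]
    simp [Algebra.smul_def]
  have h2 := congrArg Matrix.det h
  rw [Matrix.det_mul, Matrix.det_mul, mul_comm, Matrix.det_transpose, Matrix.det_diagonal] at h2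
  have h3 := mul_left_cancel₀ hM h2
  rw [Algebra.norm_eq_matrix_det B x, ← e.prod_comp, ← h3, hA]
  exact RingHom.map_det (algebraMap ℝ ℂ) _

theorem evC_ext {x y : FReal F} (h : ∀ τ : F →+* ℂ, evC τ x = evC τ y) : x = y := by
  obtain ⟨ι, _, _, B, e, hM⟩ := exists_basis_matrix F
  rw [← sub_eq_zero]
  have h0 : ∀ τ : F →+* ℂ, evC τ (x - y) = 0 := fun τ => by rw [map_sub, h, sub_self]
  generalize x - y = z at h0
  have h1 : Matrix.vecMul (fun i => ((B.repr z i : ℝ) : ℂ))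
      (Matrix.of fun i j => evC (e j) (B i)) = 0 := by
    ext j
    rw [Matrix.vecMul, dotProduct, Pi.zero_apply, ← h0 (e j)]
    conv_rhs => rw [← B.sum_repr z, map_sum]
    simp [Algebra.smul_def]
  have h2 := Matrix.eq_zero_of_vecMul_eq_zero hM h1
  refine B.ext_elem fun i => ?_
  have := congrFun h2 i
  simpa using this

theorem evC_embedding_mk (τ : F →+* ℂ) (b : FReal F) :
    evC τ b = evC (mk τ).embedding b ∨ evC τ b = starRingEnd ℂ (evC (mk τ).embedding b) := by
  rcases embedding_mk_eq τ with h | h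
  · left
    rw [h]
  · right
    rw [h, evC_conjugate, Complex.conj_conj]

theorem norm_evC_embedding_mk (τ : F →+* ℂ) (b : FReal F) :
    ‖evC (mk τ).embedding b‖ = ‖evC τ b‖ := by
  rcases evC_embedding_mk τ b with h | h <;> rw [h]
  rw [RCLike.norm_conj]

theorem evC_ext' {x y : FReal F}
    (h : ∀ w : InfinitePlace F, evC w.embedding x = evC w.embedding y) : x = y := by
  refine evC_ext fun τ => ?_
  rcases embedding_mk_eq τ with hτ | hτ
  · rw [← hτ]
    exact h _
  · rw [← star_involutive.eq_iff] at hτ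
    have hτ' : τ = conjugate (mk τ).embedding := hτ.symm
    rw [hτ', evC_conjugate, evC_conjugate, h]

theorem exists_evC_eq (z : InfinitePlace F → ℂ)
    (hz : ∀ w : InfinitePlace F, w.IsReal → starRingEnd ℂ (z w) = z w) :
    ∃ b : FReal F, ∀ w : InfinitePlace F, evC w.embedding b = z w := by
  let L : FReal F →ₗ[ℝ] mixedEmbedding.mixedSpace F :=
    LinearMap.prod
      (LinearMap.pi fun w => Complex.reLm.comp (evC w.1.embedding).toLinearMap)
      (LinearMap.pi fun w => (evC w.1.embedding).toLinearMap)
  have hL1 : ∀ b (w : {w : InfinitePlace F // w.IsReal}),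
      (((L b).1 w : ℝ) : ℂ) = evC w.1.embedding b := fun b w =>
    Complex.conj_eq_iff_re.mp (evC_eq_of_isReal (isReal_iff.mp w.2) b)
  have hL2 : ∀ b (w : {w : InfinitePlace F // w.IsComplex}),
      (L b).2 w = evC w.1.embedding b := fun b w => rfl
  have hinj : Function.Injective L := by
    intro x y hxy
    refine evC_ext' fun w => ?_
    rcases isReal_or_isComplex w with hw | hw
    · rw [← hL1 x ⟨w, hw⟩, ← hL1 y ⟨w, hw⟩, hxy]
    · rw [← hL2 x ⟨w, hw⟩, ← hL2 y ⟨w, hw⟩, hxy]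
  have hsurj : Function.Surjective L := by
    refine (LinearMap.injective_iff_surjective_of_finrank_eq_finrank ?_).mp hinj
    rw [mixedEmbedding.finrank, Module.finrank_baseChange]
  obtain ⟨b, hb⟩ := hsurj ⟨fun w => (z w.1).re, fun w => z w.1⟩
  refine ⟨b, fun w => ?_⟩
  rcases isReal_or_isComplex w with hw | hw
  · rw [← hL1 b ⟨w, hw⟩, hb]
    exact Complex.conj_eq_iff_re.mp (hz w hw)
  · rw [← hL2 b ⟨w, hw⟩, hb]

theorem abs_norm_eq_prod (x : FReal F) :
    |Algebra.norm ℝ x| = ∏ w : InfinitePlace F, ‖evC w.embedding x‖ ^ w.mult := by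
  classical
  rw [← Real.norm_eq_abs, ← Complex.norm_real, norm_eq_prod_evC, norm_prod,
    ← Finset.prod_fiberwise Finset.univ mk (fun τ : F →+* ℂ => ‖evC τ x‖)]
  refine Finset.prod_congr rfl fun w _ => ?_
  rw [Finset.prod_congr rfl (fun τ hτ => ?_), Finset.prod_const, card_filter_mk_eq]
  rw [← (Finset.mem_filter.mp hτ).2, norm_evC_embedding_mk]

end

end Evaluation

section UnitTopology

open ComplexEmbedding InfinitePlace

variable {F : Type} [Field F] [NumberField F]

/-- The `ℝ`-linear map from `F_ℝ` to the product of copies of `ℂ` indexed by the places. -/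
noncomputable def evPlaces (F : Type) [Field F] [NumberField F] :
    FReal F →ₗ[ℝ] (InfinitePlace F → ℂ) :=
  LinearMap.pi fun w => (evC w.embedding).toLinearMap

theorem isInducing_evPlaces : Topology.IsInducing (evPlaces F) := by
  have : IsTopologicalAddGroup (FReal F) :=
    topologicalAddGroup_induced (Module.finBasis ℝ (FReal F)).equivFun
  have : ContinuousSMul ℝ (FReal F) :=
    continuousSMul_induced (Module.finBasis ℝ (FReal F)).equivFun
  have : T2Space (FReal F) :=
    (Topology.IsEmbedding.mk ⟨rfl⟩ (Module.finBasis ℝ (FReal F)).equivFun.injective).t2Space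
  refine (LinearMap.isClosedEmbedding_of_injective (f := evPlaces F) ?_).isInducing
  rw [LinearMap.ker_eq_bot]
  exact fun x y h => evC_ext' fun w => congrFun h w

theorem evC_unit_ne_zero (τ : F →+* ℂ) (b : (FReal F)ˣ) : evC τ (b : FReal F) ≠ 0 :=
  (b.isUnit.map (evC τ)).ne_zero

theorem evC_units_inv (τ : F →+* ℂ) (b : (FReal F)ˣ) :
    evC τ ((b⁻¹ : (FReal F)ˣ) : FReal F) = (evC τ (b : FReal F))⁻¹ := by
  refine eq_inv_of_mul_eq_one_left ?_
  rw [← map_mul, Units.inv_mul, map_one]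

theorem continuous_units_iff {X : Type*} [TopologicalSpace X] {f : X → (FReal F)ˣ} :
    Continuous f ↔ ∀ w : InfinitePlace F, Continuous fun x => evC w.embedding (f x : FReal F) := by
  have key : ∀ h : X → FReal F, Continuous h ↔
      ∀ w : InfinitePlace F, Continuous fun x => evC w.embedding (h x) := fun h => by
    rw [isInducing_evPlaces.continuous_iff, continuous_pi_iff]
    rfl
  rw [Units.continuous_iff, key, key]
  refine ⟨fun h => h.1, fun h => ⟨h, fun w => ?_⟩⟩
  simp only [evC_units_inv]
  exact (h w).inv₀ fun x => evC_unit_ne_zero _ _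

theorem continuous_evC_units (w : InfinitePlace F) :
    Continuous fun b : (FReal F)ˣ => evC w.embedding (b : FReal F) :=
  continuous_units_iff.mp continuous_id w

theorem continuous_evC_units' (τ : F →+* ℂ) :
    Continuous fun b : (FReal F)ˣ => evC τ (b : FReal F) := by
  rcases embedding_mk_eq τ with h | h
  · have := continuous_evC_units (mk τ)
    rwa [h] at this
  · have h1 := Complex.continuous_conj.comp (continuous_evC_units (mk τ))
    rw [h] at h1
    simpa [Function.comp_def, evC_conjugate] using h1

theorem units_ext {x y : (FReal F)ˣ}
    (h : ∀ w : InfinitePlace F, evC w.embedding (x : FReal F) = evC w.embedding (y : FReal F)) :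
    x = y :=
  Units.ext (evC_ext' h)

theorem exists_unit_evC_eq (z : InfinitePlace F → ℂ) (h0 : ∀ w, z w ≠ 0)
    (hz : ∀ w : InfinitePlace F, w.IsReal → starRingEnd ℂ (z w) = z w) :
    ∃ b : (FReal F)ˣ, ∀ w : InfinitePlace F, evC w.embedding (b : FReal F) = z w := by
  obtain ⟨b, hb⟩ := exists_evC_eq z hz
  obtain ⟨c, hc⟩ := exists_evC_eq (fun w => (z w)⁻¹) fun w hw => by rw [map_inv₀, hz w hw]
  have hbc : b * c = 1 := evC_ext' fun w => by
    rw [map_mul, hb, hc, map_one, mul_inv_cancel₀ (h0 w)]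
  exact ⟨⟨b, c, hbc, by rw [mul_comm, hbc]⟩, hb⟩

/-- The unit of `F_ℝ` with prescribed nonzero components at the archimedean places. -/
noncomputable def unitOf (z : InfinitePlace F → ℂ) (h0 : ∀ w, z w ≠ 0)
    (hz : ∀ w : InfinitePlace F, w.IsReal → starRingEnd ℂ (z w) = z w) : (FReal F)ˣ :=
  (exists_unit_evC_eq z h0 hz).choose

@[simp]
theorem evC_unitOf (z : InfinitePlace F → ℂ) (h0 : ∀ w, z w ≠ 0)
    (hz : ∀ w : InfinitePlace F, w.IsReal → starRingEnd ℂ (z w) = z w) (w : InfinitePlace F) :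
    evC w.embedding (unitOf z h0 hz : FReal F) = z w :=
  (exists_unit_evC_eq z h0 hz).choose_spec w

/-- The subgroup of units of `F_ℝ` of absolute value one at every archimedean place. -/
def normOne (F : Type) [Field F] [NumberField F] : Subgroup (FReal F)ˣ where
  carrier := {b | ∀ w : InfinitePlace F, ‖evC w.embedding (b : FReal F)‖ = 1}
  one_mem' w := by simp
  mul_mem' hx hy w := by simp [hx w, hy w]
  inv_mem' {x} hx w := by
    rw [evC_units_inv, norm_inv]
    simp [hx w]

theorem mem_normOne {b : (FReal F)ˣ} :
    b ∈ normOne F ↔ ∀ w : InfinitePlace F, ‖evC w.embedding (b : FReal F)‖ = 1 :=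
  Iff.rfl

theorem mem_normOne' {b : (FReal F)ˣ} :
    b ∈ normOne F ↔ ∀ τ : F →+* ℂ, ‖evC τ (b : FReal F)‖ = 1 :=
  ⟨fun h τ => by rw [← norm_evC_embedding_mk]; exact h _, fun h w => h _⟩

theorem isCompact_normOne : IsCompact (normOne F : Set (FReal F)ˣ) := by
  let Z : Set (InfinitePlace F → ℂ) :=
    {z | ∀ w, z w ∈ Metric.sphere (0 : ℂ) 1 ∩ {x | w.IsReal → starRingEnd ℂ x = x}}
  have hZ : IsCompact Z := by
    have : Z = Set.univ.pi fun w : InfinitePlace F =>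
        Metric.sphere (0 : ℂ) 1 ∩ {x | w.IsReal → starRingEnd ℂ x = x} := by
      ext z
      simp [Z]
    rw [this]
    refine isCompact_univ_pi fun w => (isCompact_sphere _ _).inter_right ?_
    by_cases hw : w.IsReal
    · simpa [hw] using isClosed_eq Complex.continuous_conj continuous_id
    · simp [hw]
  have h0 : ∀ z : Z, ∀ w, z.1 w ≠ 0 := fun z w => by
    have := (z.2 w).1
    rw [mem_sphere_zero_iff_norm] at this
    exact norm_ne_zero_iff.mp (by rw [this]; exact one_ne_zero)
  have hr : ∀ z : Z, ∀ w : InfinitePlace F, w.IsReal → starRingEnd ℂ (z.1 w) = z.1 w :=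
    fun z w => (z.2 w).2
  have := isCompact_iff_compactSpace.mp hZ
  have hc : Continuous fun z : Z => unitOf z.1 (h0 z) (hr z) := by
    rw [continuous_units_iff]
    intro w
    simp only [evC_unitOf]
    exact (continuous_apply w).comp continuous_subtype_val
  convert isCompact_range hc
  ext b
  constructor
  · intro hb
    refine ⟨⟨fun w => evC w.embedding (b : FReal F), fun w =>
      ⟨mem_sphere_zero_iff_norm.mpr (hb w), fun hw =>
        evC_eq_of_isReal (isReal_iff.mp hw) _⟩⟩, units_ext fun w => ?_⟩
    simp
  · rintro ⟨z, rfl⟩ w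
    simpa using mem_sphere_zero_iff_norm.mp (z.2 w).1

theorem maxCompact_eq_normOne : maxCompact F = normOne F := by
  refine le_antisymm (sSup_le fun H hH => ?_) (le_sSup isCompact_normOne)
  have key : ∀ b ∈ H, ∀ w : InfinitePlace F, ‖evC w.embedding (b : FReal F)‖ ≤ 1 := by
    intro b hb w
    by_contra! h1
    obtain ⟨C, hC⟩ := hH.exists_bound_of_continuousOn (continuous_evC_units w).continuousOn
    obtain ⟨n, hn⟩ := pow_unbounded_of_one_lt C h1
    have := hC (b ^ n) (H.pow_mem hb n)
    rw [Units.val_pow_eq_pow_val, map_pow, norm_pow] at this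
    linarith
  intro b hb w
  refine le_antisymm (key b hb w) ?_
  have h2 := key b⁻¹ (H.inv_mem hb) w
  rw [evC_units_inv, norm_inv] at h2
  exact (inv_le_one₀ (norm_pos_iff.mpr (evC_unit_ne_zero _ b))).mp h2

end UnitTopology

section Characters

open ComplexEmbedding InfinitePlace

variable {F : Type} [Field F] [NumberField F]

/-- The character of `F_ℝˣ` attached to a family of integers indexed by the embeddings. -/
noncomputable def unitChar (n : (F →+* ℂ) → ℤ) (b : (FReal F)ˣ) : RmodZ :=
  ∑ τ : F →+* ℂ, n τ • argC (evC τ (b : FReal F))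

theorem unitChar_mul (n : (F →+* ℂ) → ℤ) (b c : (FReal F)ˣ) :
    unitChar n (b * c) = unitChar n b + unitChar n c := by
  simp only [unitChar, ← Finset.sum_add_distrib, ← smul_add]
  refine Finset.sum_congr rfl fun τ _ => ?_
  rw [Units.val_mul, map_mul, argC_mul (evC_unit_ne_zero _ _) (evC_unit_ne_zero _ _)]

theorem unitChar_add (n m : (F →+* ℂ) → ℤ) (b : (FReal F)ˣ) :
    unitChar (n + m) b = unitChar n b + unitChar m b := by
  simp only [unitChar, ← Finset.sum_add_distrib, Pi.add_apply, add_smul]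

theorem continuous_unitChar (n : (F →+* ℂ) → ℤ) : Continuous (unitChar n) :=
  continuous_finsetSum _ fun τ _ => Continuous.zsmul
    (continuous_iff_continuousAt.mpr fun b =>
      ContinuousAt.comp (f := fun b : (FReal F)ˣ => evC τ (b : FReal F))
        (continuousAt_argC (evC_unit_ne_zero τ b)) (continuous_evC_units' τ).continuousAt) _

theorem sum_embeddings {A : Type*} [AddCommMonoid A] (f : (F →+* ℂ) → A) :
    ∑ τ, f τ = ∑ w : InfinitePlace F, open Classical in
      if w.IsReal then f w.embedding else f w.embedding + f (conjugate w.embedding) := by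
  classical
  rw [← Finset.sum_fiberwise Finset.univ mk f]
  refine Finset.sum_congr rfl fun w _ => ?_
  have h : Finset.univ.filter (fun τ : F →+* ℂ => mk τ = w) =
      {w.embedding, conjugate w.embedding} := by
    ext τ
    rw [Finset.mem_filter, Finset.mem_insert, Finset.mem_singleton]
    conv_lhs => rw [← mk_embedding w, eq_comm (a := mk τ), mk_eq_iff]
    simp [eq_comm]
  rw [h]
  split_ifs with hw
  · rw [conjugate_embedding_eq_of_isReal hw]
    simp
  · rw [Finset.sum_pair]
    intro h'
    exact hw (isReal_iff.mpr (ComplexEmbedding.isReal_iff.mpr h'.symm))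

/-- The exponent at an archimedean place of the character attached to a family of integers. -/
noncomputable def charExp (n : (F →+* ℂ) → ℤ) (w : InfinitePlace F) : ℤ :=
  open Classical in
  if w.IsReal then n w.embedding else n w.embedding - n (conjugate w.embedding)

theorem unitChar_eq (n : (F →+* ℂ) → ℤ) (b : (FReal F)ˣ) :
    unitChar n b = ∑ w : InfinitePlace F, charExp n w • argC (evC w.embedding (b : FReal F)) := by
  rw [unitChar, sum_embeddings]
  refine Finset.sum_congr rfl fun w _ => ?_
  rw [charExp]
  split_ifs with hw
  · rfl
  · rw [evC_conjugate, argC_conj, smul_neg, sub_smul, sub_eq_add_neg]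

theorem exists_placeUnit (w : InfinitePlace F) (z : ℂ) (hz0 : z ≠ 0)
    (hz : w.IsReal → starRingEnd ℂ z = z) :
    ∃ b : (FReal F)ˣ, evC w.embedding (b : FReal F) = z ∧
      ∀ v ≠ w, evC v.embedding (b : FReal F) = 1 := by
  classical
  obtain ⟨b, hb⟩ := exists_unit_evC_eq (F := F) (Function.update 1 w z)
    (fun v => by
      rcases eq_or_ne v w with rfl | hv
      · simpa using hz0
      · simp [hv])
    (fun v hv => by
      rcases eq_or_ne v w with rfl | hvw
      · simpa using hz hv
      · simp [hvw])
  exact ⟨b, by simp [hb], fun v hv => by simp [hb, hv]⟩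

/-- The unit of `F_ℝ` with a given component at one place and trivial components elsewhere. -/
noncomputable def placeUnit (w : InfinitePlace F) (z : ℂ) (hz0 : z ≠ 0)
    (hz : w.IsReal → starRingEnd ℂ z = z) : (FReal F)ˣ :=
  (exists_placeUnit w z hz0 hz).choose

section

variable {w : InfinitePlace F} {z : ℂ} {hz0 : z ≠ 0} {hz : w.IsReal → starRingEnd ℂ z = z}

@[simp]
theorem evC_placeUnit : evC w.embedding (placeUnit w z hz0 hz : FReal F) = z :=
  (exists_placeUnit w z hz0 hz).choose_spec.1

theorem evC_placeUnit_of_ne {v : InfinitePlace F} (hv : v ≠ w) :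
    evC v.embedding (placeUnit w z hz0 hz : FReal F) = 1 :=
  (exists_placeUnit w z hz0 hz).choose_spec.2 v hv

theorem placeUnit_mem (h : ‖z‖ = 1) : placeUnit w z hz0 hz ∈ normOne F := by
  intro v
  rcases eq_or_ne v w with rfl | hv
  · rwa [evC_placeUnit]
  · rw [evC_placeUnit_of_ne hv, norm_one]

theorem unitChar_placeUnit (n : (F →+* ℂ) → ℤ) :
    unitChar n (placeUnit w z hz0 hz) = charExp n w • argC z := by
  rw [unitChar_eq, Finset.sum_eq_single w]
  · rw [evC_placeUnit]
  · intro v _ hv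
    rw [evC_placeUnit_of_ne hv, argC_one, smul_zero]
  · simp

end

theorem norm_one_ne_zero {z : ℂ} (h : ‖z‖ = 1) : z ≠ 0 :=
  norm_ne_zero_iff.mp (by rw [h]; exact one_ne_zero)

theorem unitChar_eq_zero_iff (n : (F →+* ℂ) → ℤ) :
    (∀ b ∈ normOne F, unitChar n b = 0) ↔
      ∀ w : InfinitePlace F, (w.IsReal → Even (charExp n w)) ∧ (w.IsComplex → charExp n w = 0) := by
  constructor
  · intro h w
    refine ⟨fun hw => ?_, fun hw => ?_⟩
    · have := h _ (placeUnit_mem (w := w) (z := -1) (hz0 := by simp) (hz := by simp) (by simp))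
      rwa [unitChar_placeUnit, zsmul_argC_neg_one_eq_zero_iff] at this
    · refine eq_zero_of_forall_zsmul_eq_zero fun x => ?_
      obtain ⟨z, hz, rfl⟩ := exists_norm_eq_one_argC_eq x
      have := h _ (placeUnit_mem (w := w) (z := z) (hz0 := norm_one_ne_zero hz)
        (hz := fun hw' => absurd hw' (not_isReal_iff_isComplex.mpr hw)) hz)
      rwa [unitChar_placeUnit] at this
  · intro h b hb
    rw [unitChar_eq]
    refine Finset.sum_eq_zero fun w _ => ?_
    rcases isReal_or_isComplex w with hw | hw
    · obtain ⟨k, hk⟩ := (h w).1 hw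
      have h1 : evC w.embedding (b : FReal F) * evC w.embedding (b : FReal F) = 1 := by
        conv_lhs =>
          enter [1]
          rw [← evC_eq_of_isReal (isReal_iff.mp hw)]
        rw [mul_comm, Complex.mul_conj, Complex.normSq_eq_norm_sq, hb w]
        simp
      rw [hk, add_smul, ← smul_add, ← argC_mul (evC_unit_ne_zero _ _) (evC_unit_ne_zero _ _), h1,
        argC_one, smul_zero]
    · rw [(h w).2 hw, zero_smul]

/-- The families of integers attached to the archimedean places. -/
noncomputable def placeFamily (x : InfinitePlace F →₀ ℤ) (τ : F →+* ℂ) : ℤ :=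
  open Classical in (if ComplexEmbedding.IsReal τ then 2 else 1) * x (mk τ)

omit [NumberField F] in
theorem placeFamily_injective : Function.Injective (placeFamily (F := F)) := by
  intro x y h
  ext w
  have h' := congrFun h w.embedding
  simp only [placeFamily, mk_embedding] at h'
  refine mul_left_cancel₀ ?_ h'
  split_ifs <;> simp

theorem exists_placeFamily_iff (n : (F →+* ℂ) → ℤ) :
    (∃ x, placeFamily x = n) ↔ ∀ b ∈ normOne F, unitChar n b = 0 := by
  rw [unitChar_eq_zero_iff]
  constructor
  · rintro ⟨x, rfl⟩ w
    refine ⟨fun hw => ?_, fun hw => ?_⟩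
    · rw [charExp, if_pos hw, placeFamily, if_pos (isReal_iff.mp hw)]
      exact even_two_mul _
    · rw [charExp, if_neg (not_isReal_iff_isComplex.mpr hw), placeFamily, placeFamily,
        mk_conjugate_eq, isReal_conjugate_iff, sub_self]
  · intro h
    classical
    refine ⟨Finsupp.equivFunOnFinite.symm fun w =>
      if w.IsReal then n w.embedding / 2 else n w.embedding, funext fun τ => ?_⟩
    have hw := h (mk τ)
    simp only [placeFamily, Finsupp.equivFunOnFinite_symm_apply_apply, isReal_mk_iff]
    split_ifs with hτ
    · have h1 := hw.1 (isReal_mk_iff.mpr hτ)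
      rw [charExp, if_pos (isReal_mk_iff.mpr hτ), embedding_mk_eq_of_isReal hτ] at h1
      rw [embedding_mk_eq_of_isReal hτ]
      exact Int.two_mul_ediv_two_of_even h1
    · have h1 := hw.2 (isComplex_mk_iff.mpr hτ)
      rw [charExp, if_neg (isReal_mk_iff.not.mpr hτ), sub_eq_zero] at h1
      rw [one_mul]
      rcases embedding_mk_eq τ with h2 | h2
      · rw [h2]
      · rw [h1, h2]
        congr 1
        exact star_star τ

theorem exists_zsmul_argC_of_place (χ : normOne F → RmodZ) (hc : Continuous χ)
    (hmul : ∀ b c, χ (b * c) = χ b + χ c) (w : InfinitePlace F) :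
    ∃ n : ℤ, ∀ b : normOne F, (∀ v ≠ w, evC v.embedding ((b : (FReal F)ˣ) : FReal F) = 1) →
      χ b = n • argC (evC w.embedding ((b : (FReal F)ˣ) : FReal F)) := by
  have hone : χ 1 = 0 := by simpa using hmul 1 1
  have hext : ∀ b c : normOne F, (∀ v ≠ w, evC v.embedding ((b : (FReal F)ˣ) : FReal F) = 1) →
      (∀ v ≠ w, evC v.embedding ((c : (FReal F)ˣ) : FReal F) = 1) →
      evC w.embedding ((b : (FReal F)ˣ) : FReal F) = evC w.embedding ((c : (FReal F)ˣ) : FReal F) →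
      b = c := by
    intro b c hb hc h
    refine Subtype.ext (units_ext fun v => ?_)
    rcases eq_or_ne v w with rfl | hv
    · exact h
    · rw [hb v hv, hc v hv]
  rcases isReal_or_isComplex w with hw | hw
  · have hm0 : (-1 : ℂ) ≠ 0 := by simp
    have hm1 : w.IsReal → starRingEnd ℂ (-1) = -1 := by simp
    let b₀ : normOne F := ⟨placeUnit w (-1) hm0 hm1, placeUnit_mem (by simp)⟩
    have hb₀ : evC w.embedding ((b₀ : (FReal F)ˣ) : FReal F) = -1 :=
      evC_placeUnit (hz0 := hm0) (hz := hm1)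
    have hb₀' : ∀ v ≠ w, evC v.embedding ((b₀ : (FReal F)ˣ) : FReal F) = 1 :=
      fun v hv => evC_placeUnit_of_ne (hz0 := hm0) (hz := hm1) hv
    have hsq : b₀ * b₀ = 1 := hext _ _ (fun v hv => by simp [hb₀' v hv]) (fun v hv => by simp)
      (by simp [hb₀])
    obtain ⟨n, hn⟩ := exists_zsmul_argC_neg_one (x := χ b₀) (by rw [← hmul, hsq, hone])
    refine ⟨n, fun b hb => ?_⟩
    have h1 : evC w.embedding ((b : (FReal F)ˣ) : FReal F) = 1 ∨
        evC w.embedding ((b : (FReal F)ˣ) : FReal F) = -1 := by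
      rw [← mul_self_eq_one_iff]
      conv_lhs =>
        enter [1]
        rw [← evC_eq_of_isReal (isReal_iff.mp hw)]
      rw [mul_comm, Complex.mul_conj, Complex.normSq_eq_norm_sq, b.2 w]
      simp
    rcases h1 with h1 | h1
    · rw [h1, argC_one, smul_zero, ← hone]
      congr 1
      exact hext _ _ hb (fun v hv => by simp) (by simp [h1])
    · rw [h1, ← hn]
      congr 1
      exact hext _ _ hb hb₀' (by rw [h1, hb₀])
  · have hnorm : ∀ t : ℝ, ‖Complex.exp (2 * Real.pi * t * Complex.I)‖ = 1 := fun t => by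
      exact_mod_cast Complex.norm_exp_ofReal_mul_I (2 * Real.pi * t)
    let e : ℝ → normOne F := fun t => ⟨_, placeUnit_mem (w := w)
      (z := Complex.exp (2 * Real.pi * t * Complex.I)) (hz0 := Complex.exp_ne_zero _)
      (hz := fun hw' => absurd hw' (not_isReal_iff_isComplex.mpr hw)) (hnorm t)⟩
    have he : ∀ t, evC w.embedding ((e t : (FReal F)ˣ) : FReal F) =
        Complex.exp (2 * Real.pi * t * Complex.I) := fun t =>
      evC_placeUnit (hz0 := Complex.exp_ne_zero _)
        (hz := fun hw' => absurd hw' (not_isReal_iff_isComplex.mpr hw))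
    have he' : ∀ t, ∀ v ≠ w, evC v.embedding ((e t : (FReal F)ˣ) : FReal F) = 1 :=
      fun t v hv => evC_placeUnit_of_ne (hz0 := Complex.exp_ne_zero _)
        (hz := fun hw' => absurd hw' (not_isReal_iff_isComplex.mpr hw)) hv
    have hec : Continuous e := by
      refine Continuous.subtype_mk (continuous_units_iff.mpr fun v => ?_) _
      rcases eq_or_ne v w with rfl | hv
      · simp only [evC_placeUnit]
        fun_prop
      · simp only [evC_placeUnit_of_ne hv]
        exact continuous_const
    obtain ⟨n, hn⟩ := exists_int_lift (fun t => χ (e t)) (hc.comp hec)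
      (fun s t => by
        rw [← hmul]
        congr 1
        refine hext _ _ (he' _) (fun v hv => by simp [he' _ v hv]) ?_
        simp only [Subgroup.coe_mul, Units.val_mul, map_mul, he, ← Complex.exp_add]
        congr 1
        push_cast
        ring)
      (by
        rw [← hone]
        congr 1
        refine hext _ _ (he' _) (fun v hv => by simp) ?_
        simp [he, Complex.exp_two_pi_mul_I])
    refine ⟨n, fun b hb => ?_⟩
    obtain ⟨t, ht⟩ := QuotientAddGroup.mk_surjective
      (argC (evC w.embedding ((b : (FReal F)ˣ) : FReal F)))
    have ht' : evC w.embedding ((b : (FReal F)ˣ) : FReal F) =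
        Complex.exp (2 * Real.pi * t * Complex.I) :=
      argC_inj (b.2 w) (hnorm t) (by rw [argC_exp]; exact ht.symm)
    rw [ht', argC_exp, ← hn]
    congr 1
    exact hext _ _ hb (he' t) (by rw [ht', he])

theorem exists_unitChar_eq (χ : normOne F → RmodZ) (hc : Continuous χ)
    (hmul : ∀ b c, χ (b * c) = χ b + χ c) :
    ∃ n : (F →+* ℂ) → ℤ, ∀ b : normOne F, χ b = unitChar n b := by
  classical
  choose m hm using exists_zsmul_argC_of_place χ hc hmul
  refine ⟨fun τ => if τ = (mk τ).embedding then m (mk τ) else 0, fun b => ?_⟩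
  have hexp : ∀ w, charExp (fun τ : F →+* ℂ => if τ = (mk τ).embedding then m (mk τ) else 0) w =
      m w := by
    intro w
    rw [charExp]
    by_cases hw : w.IsReal
    · simp [hw]
    · have : conjugate w.embedding ≠ w.embedding := fun h =>
        hw (isReal_iff.mpr (ComplexEmbedding.isReal_iff.mpr h))
      simp [hw, mk_conjugate_eq, this]
  let e : InfinitePlace F → normOne F := fun w => ⟨_, placeUnit_mem (w := w)
    (z := evC w.embedding ((b : (FReal F)ˣ) : FReal F)) (hz0 := evC_unit_ne_zero _ _)
    (hz := fun hw => evC_eq_of_isReal (isReal_iff.mp hw) _) (b.2 w)⟩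
  have he : ∀ w, evC w.embedding ((e w : (FReal F)ˣ) : FReal F) =
      evC w.embedding ((b : (FReal F)ˣ) : FReal F) := fun w =>
    evC_placeUnit (hz0 := evC_unit_ne_zero _ _)
      (hz := fun hw => evC_eq_of_isReal (isReal_iff.mp hw) _)
  have he' : ∀ w, ∀ v ≠ w, evC v.embedding ((e w : (FReal F)ˣ) : FReal F) = 1 := fun w v hv =>
    evC_placeUnit_of_ne (hz0 := evC_unit_ne_zero _ _)
      (hz := fun hw => evC_eq_of_isReal (isReal_iff.mp hw) _) hv
  have hb : b = ∏ w, e w := by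
    refine Subtype.ext (units_ext fun v => ?_)
    rw [Subgroup.val_finsetProd, Units.coe_prod, map_prod, Finset.prod_eq_single v]
    · exact (he v).symm
    · intro w _ hw
      exact he' w v hw.symm
    · simp
  let χ' : normOne F →* Multiplicative RmodZ :=
    { toFun := fun b => Multiplicative.ofAdd (χ b)
      map_one' := by
        have hone : χ 1 = 0 := by simpa using hmul 1 1
        rw [hone]
        rfl
      map_mul' := fun b c => by
        rw [hmul]
        rfl }
  have h1 : χ b = ∑ w, χ (e w) := by
    have := map_prod χ' e Finset.univ
    rw [← hb] at this
    have h2 := congrArg Multiplicative.toAdd this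
    rw [toAdd_prod] at h2
    exact h2
  rw [h1, unitChar_eq]
  refine Finset.sum_congr rfl fun w _ => ?_
  rw [hexp, hm w (e w) (he' w), he]

end Characters

section Permutation

variable {K F : Type} [Field K] [NumberField K] [Field F] [NumberField F] [Algebra K F]
  {G : Type} [Group G]

section

variable [Module (MonoidAlgebra ℤ G) ((F →+* ℂ) → ℤ)] (iso : G ≃* (F ≃ₐ[K] F))
  (hP : ∀ (g : G) (n : (F →+* ℂ) → ℤ) (τ : F →+* ℂ),
    ((MonoidAlgebra.single g (1 : ℤ) : MonoidAlgebra ℤ G) • n) τ =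
      n (τ.comp (iso g : F →+* F)))

include hP

omit [NumberField K] [NumberField F] in
theorem groupRing_smul_family [Fintype G] (r : MonoidAlgebra ℤ G) (n : (F →+* ℂ) → ℤ)
    (τ : F →+* ℂ) :
    (r • n) τ = ∑ g : G, r.coeff g * n (τ.comp (iso g : F →+* F)) := by
  classical
  induction r using MonoidAlgebra.induction_on with
  | of g =>
    rw [MonoidAlgebra.of_apply, hP, Finset.sum_eq_single g]
    · simp
    · intro h _ hh
      simp [Ne.symm hh]
    · simp
  | add x y hx hy => simp [add_smul, hx, hy, add_mul, Finset.sum_add_distrib]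
  | smul k x hx =>
    have h : ∀ g, (k • x).coeff g = k * x.coeff g := fun g => rfl
    rw [smul_assoc, Pi.smul_apply, hx, smul_eq_mul, Finset.mul_sum]
    simp only [h, mul_assoc]

theorem cls_embeddings [IsGalois K F] :
    G0.cls (MonoidAlgebra ℤ G) ((F →+* ℂ) → ℤ) =
      Module.finrank ℚ K • G0.cls (MonoidAlgebra ℤ G) (MonoidAlgebra ℤ G) := by
  classical
  have : FiniteDimensional K F := Module.Finite.of_restrictScalars_finite ℚ K F
  have : Fintype G := Fintype.ofEquiv _ iso.symm.toEquiv
  have hext : ∀ κ : K →+* ℂ, ∃ τ : F →+* ℂ, τ.comp (algebraMap K F) = κ := fun κ => by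
    let := κ.toAlgebra
    exact ⟨(IsAlgClosed.lift : F →ₐ[K] ℂ).toRingHom, (IsAlgClosed.lift : F →ₐ[K] ℂ).comp_algebraMap⟩
  choose ext hext using hext
  have hcomp : ∀ (τ : F →+* ℂ) (s : F ≃ₐ[K] F),
      (τ.comp (s : F →+* F)).comp (algebraMap K F) = τ.comp (algebraMap K F) := fun τ s => by
    ext x
    simp
  have hinj : ∀ κ κ' (g g' : G), ((ext κ).comp (iso g⁻¹ : F →+* F)).comp (iso g' : F →+* F) =
      ext κ' ↔ κ = κ' ∧ g = g' := by
    intro κ κ' g g'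
    constructor
    · intro h
      have h1 : κ = κ' := by rw [← hext κ, ← hext κ', ← h, hcomp, hcomp]
      subst h1
      refine ⟨rfl, ?_⟩
      have h2 : iso (g⁻¹ * g') = 1 := by
        ext x
        have := RingHom.congr_fun h x
        simpa using (ext κ).injective this
      rw [EmbeddingLike.map_eq_one_iff, inv_mul_eq_one] at h2
      exact h2
    · rintro ⟨rfl, rfl⟩
      ext x
      simp
  have hsurj : ∀ τ : F →+* ℂ, ∃ κ g, τ = (ext κ).comp (iso g⁻¹ : F →+* F) := by
    intro τ
    obtain ⟨s, hs⟩ := ComplexEmbedding.exists_comp_symm_eq_of_comp_eq (k := K)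
      (ext (τ.comp (algebraMap K F))) τ (hext _)
    refine ⟨τ.comp (algebraMap K F), iso.symm s, ?_⟩
    conv_lhs => rw [← hs]
    ext x
    simp
  let Φ := Fintype.linearCombination (MonoidAlgebra ℤ G)
    (fun κ : K →+* ℂ => (Pi.single (ext κ) 1 : (F →+* ℂ) → ℤ))
  have hΦ : ∀ r κ g, Φ r ((ext κ).comp (iso g⁻¹ : F →+* F)) = (r κ).coeff g := by
    intro r κ g
    rw [Fintype.linearCombination_apply, Finset.sum_apply, Finset.sum_eq_single κ]
    · rw [groupRing_smul_family iso hP, Finset.sum_eq_single g]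
      · rw [(hinj κ κ g g).mpr ⟨rfl, rfl⟩]
        simp
      · intro g' _ hg'
        rw [Pi.single_eq_of_ne, mul_zero]
        exact fun h => hg' ((hinj _ _ _ _).mp h).2.symm
      · simp
    · intro κ' _ hκ'
      rw [groupRing_smul_family iso hP]
      refine Finset.sum_eq_zero fun g' _ => ?_
      rw [Pi.single_eq_of_ne, mul_zero]
      exact fun h => hκ' ((hinj _ _ _ _).mp h).1.symm
    · simp
  have hbij : Function.Bijective Φ := by
    constructor
    · intro r s h
      refine funext fun κ => MonoidAlgebra.ext (Finsupp.ext fun g => ?_)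
      rw [← hΦ, ← hΦ, h]
    · intro n
      refine ⟨fun κ => MonoidAlgebra.ofCoeff (Finsupp.equivFunOnFinite.symm fun g =>
        n ((ext κ).comp (iso g⁻¹ : F →+* F))), funext fun τ => ?_⟩
      obtain ⟨κ, g, rfl⟩ := hsurj τ
      rw [hΦ]
      rfl
  rw [← G0.cls_congr (LinearEquiv.ofBijective Φ hbij), G0.cls_fun,
    NumberField.Embeddings.card]

end

end Permutation

section extension

open InfinitePlace

/-- A continuous character killing a subgroup descends to the quotient. -/
theorem exists_continuousAddMonoidHom_quotient {A : Type*} [CommGroup A] [TopologicalSpace A]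
    (N : Subgroup A) (χ : A → RmodZ) (hc : Continuous χ) (hmul : ∀ x y, χ (x * y) = χ x + χ y)
    (hN : ∀ x ∈ N, χ x = 0) :
    ∃ φ : ContinuousAddMonoidHom (Additive (A ⧸ N)) RmodZ,
      ∀ x : A, φ (Additive.ofMul (x : A ⧸ N)) = χ x := by
  let f : A →* Multiplicative RmodZ := MonoidHom.mk' (fun x => Multiplicative.ofAdd (χ x)) hmul
  let f' : A ⧸ N →* Multiplicative RmodZ := QuotientGroup.lift N f hN
  refine ⟨⟨MonoidHom.toAdditiveLeft f', ?_⟩, fun x => rfl⟩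
  exact hc.quotient_lift _

variable {F : Type} [Field F] [NumberField F]

/-- The diagonal embedding of `F^×` into the units of `F_ℝ`. -/
noncomputable def diag (F : Type) [Field F] [NumberField F] : Fˣ →* (FReal F)ˣ :=
  Units.map (Algebra.TensorProduct.includeRight : F →ₐ[ℚ] FReal F).toMonoidHom

@[simp]
theorem evC_diag (τ : F →+* ℂ) (u : Fˣ) : evC τ (diag F u : FReal F) = τ u := by
  change evC τ ((1 : ℝ) ⊗ₜ[ℚ] (u : F)) = τ u
  simp

theorem principalHom_apply (u : Fˣ) :
    principalHom F u = (toPrincipalIdeal (𝓞 F) F u, diag F u) :=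
  rfl

/-- The unit of `F` underlying a unit of the ring of integers. -/
noncomputable def unitsToField (F : Type) [Field F] [NumberField F] : (𝓞 F)ˣ →* Fˣ :=
  Units.map (algebraMap (𝓞 F) F).toMonoidHom

@[simp]
theorem coe_unitsToField (u : (𝓞 F)ˣ) :
    ((unitsToField F u : Fˣ) : F) = algebraMap (𝓞 F) F (u : 𝓞 F) :=
  rfl

theorem toPrincipalIdeal_unitsToField (u : (𝓞 F)ˣ) :
    toPrincipalIdeal (𝓞 F) F (unitsToField F u) = 1 := by
  rw [toPrincipalIdeal_eq_iff, coe_unitsToField, ← FractionalIdeal.coeIdeal_span_singleton,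
    Ideal.span_singleton_eq_top.mpr u.isUnit]
  simp

theorem exists_unitsToField_eq {α : Fˣ} (h : toPrincipalIdeal (𝓞 F) F α = 1) :
    ∃ u : (𝓞 F)ˣ, unitsToField F u = α := by
  have key : ∀ β : Fˣ, toPrincipalIdeal (𝓞 F) F β = 1 →
      ∃ x : 𝓞 F, algebraMap (𝓞 F) F x = β := fun β hβ => by
    rw [toPrincipalIdeal_eq_iff, Units.val_one] at hβ
    have := FractionalIdeal.mem_spanSingleton_self (𝓞 F)⁰ (β : F)
    rw [hβ] at this
    exact (FractionalIdeal.mem_one_iff _).mp this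
  obtain ⟨x, hx⟩ := key α h
  obtain ⟨y, hy⟩ := key α⁻¹ (by rw [map_inv, h, inv_one])
  have hxy : x * y = 1 := by
    apply FaithfulSMul.algebraMap_injective (𝓞 F) F
    rw [map_mul, hx, hy, Units.mul_inv, map_one]
  exact ⟨⟨x, y, hxy, by rw [mul_comm, hxy]⟩, Units.ext hx⟩

/-- A character of the units of `F_ℝ` killing the units of `𝓞 F` can be corrected by a character
of the ideal group so that it kills all principal elements. -/
theorem exists_ideal_char (ψ : (FReal F)ˣ → RmodZ) (hmul : ∀ b c, ψ (b * c) = ψ b + ψ c)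
    (hψ : ∀ u : (𝓞 F)ˣ, ψ (diag F (unitsToField F u)) = 0) :
    ∃ η : IdealGroup F → RmodZ, (∀ I J, η (I * J) = η I + η J) ∧
      ∀ α : Fˣ, η (toPrincipalIdeal (𝓞 F) F α) + ψ (diag F α) = 0 := by
  let f := QuotientGroup.kerLift (toPrincipalIdeal (𝓞 F) F)
  let g₀ : (FReal F)ˣ →* Multiplicative RmodZ :=
    MonoidHom.mk' (fun x => Multiplicative.ofAdd (ψ x)) hmul
  let g := QuotientGroup.lift (toPrincipalIdeal (𝓞 F) F).ker (g₀.comp (diag F)) fun α hα => by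
    obtain ⟨u, rfl⟩ := exists_unitsToField_eq hα
    exact hψ u
  obtain ⟨h, hh⟩ := (Module.Baer.of_divisible RmodZ).extension_property_addMonoidHom
    (M := Additive (Fˣ ⧸ (toPrincipalIdeal (𝓞 F) F).ker)) (N := Additive (IdealGroup F))
    (MonoidHom.toAdditive f) (QuotientGroup.kerLift_injective (toPrincipalIdeal (𝓞 F) F))
    (MonoidHom.toAdditiveLeft g)
  refine ⟨fun I => - h (Additive.ofMul I), fun I J => ?_, fun α => ?_⟩
  · simp only [ofMul_mul, map_add, neg_add]
  · have h1 : h (Additive.ofMul (toPrincipalIdeal (𝓞 F) F α)) = ψ (diag F α) :=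
      DFunLike.congr_fun hh (Additive.ofMul (QuotientGroup.mk α))
    simp only [h1, neg_add_cancel]

open Units Units.dirichletUnitTheorem

/-- The logarithmic embedding of the units of `F_ℝ`, omitting one place. -/
noncomputable def logFR (b : (FReal F)ˣ) : {w : InfinitePlace F // w ≠ w₀} → ℝ := fun w =>
  mult w.1 * Real.log ‖evC w.1.embedding (b : FReal F)‖

theorem logFR_mul (b c : (FReal F)ˣ) : logFR (b * c) = logFR b + logFR c := by
  ext w
  simp only [logFR, Pi.add_apply, Units.val_mul, map_mul, norm_mul]
  rw [Real.log_mul (norm_ne_zero_iff.mpr (evC_unit_ne_zero _ _))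
    (norm_ne_zero_iff.mpr (evC_unit_ne_zero _ _)), mul_add]

theorem continuous_logFR : Continuous (logFR (F := F)) :=
  continuous_pi fun w => continuous_const.mul <|
    (continuous_evC_units w.1).norm.log fun _ => norm_ne_zero_iff.mpr (evC_unit_ne_zero _ _)

theorem logFR_of_mem_normOne {b : (FReal F)ˣ} (hb : b ∈ normOne F) : logFR b = 0 := by
  ext w
  simp [logFR, mem_normOne.mp hb]

theorem logFR_diag (u : (𝓞 F)ˣ) :
    logFR (diag F (unitsToField F u)) = logEmbedding F (Additive.ofMul u) := by
  ext w
  rw [logEmbedding_component, logFR, evC_diag, coe_unitsToField, norm_embedding_eq]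

theorem diag_mem_normOne {u : Fˣ} (hu : u ∈ CommGroup.torsion Fˣ) : diag F u ∈ normOne F := by
  intro w
  obtain ⟨n, hn, h⟩ := isOfFinOrder_iff_pow_eq_one.mp hu
  rw [evC_diag]
  refine (pow_eq_one_iff_of_nonneg (norm_nonneg _) hn.ne').mp ?_
  rw [← norm_pow, ← map_pow, ← Units.val_pow_eq_pow_val, h]
  simp

/-- The real basis of the logarithmic space given by the fundamental units. -/
noncomputable def logBasis (F : Type) [Field F] [NumberField F] :
    Module.Basis (Fin (rank F)) ℝ ({w : InfinitePlace F // w ≠ w₀} → ℝ) :=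
  open Classical in (basisUnitLattice F).ofZLatticeBasis ℝ (unitLattice F)

theorem logBasis_apply (i : Fin (rank F)) :
    logBasis F i = logFR (diag F (unitsToField F (fundSystem F i))) := by
  rw [logBasis, Module.Basis.ofZLatticeBasis_apply, logFR_diag, logEmbedding_fundSystem]

/-- A family killing the roots of unity gives a continuous character of the units of `F_ℝ` that
agrees with it on elements of absolute value one and kills the units of `𝓞 F`. -/
theorem exists_char_kills_units (n : (F →+* ℂ) → ℤ)
    (hn : ∀ u ∈ CommGroup.torsion Fˣ, unitChar n (diag F u) = 0) :
    ∃ ψ : (FReal F)ˣ → RmodZ, Continuous ψ ∧ (∀ b c, ψ (b * c) = ψ b + ψ c) ∧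
      (∀ b ∈ normOne F, ψ b = unitChar n b) ∧
      ∀ u : (𝓞 F)ˣ, ψ (diag F (unitsToField F u)) = 0 := by
  choose c hc using fun i : Fin (rank F) => QuotientAddGroup.mk_surjective
    (- unitChar n (diag F (unitsToField F (fundSystem F i))))
  let L := (logBasis F).constr ℝ c
  let ψ : (FReal F)ˣ → RmodZ := fun b => unitChar n b + ((L (logFR b) : ℝ) : RmodZ)
  have hmul : ∀ b c, ψ (b * c) = ψ b + ψ c := fun b c => by
    simp only [ψ, unitChar_mul, logFR_mul, map_add, AddCircle.coe_add]
    abel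
  have hone : ∀ b ∈ normOne F, ψ b = unitChar n b := fun b hb => by
    simp [ψ, logFR_of_mem_normOne hb]
  refine ⟨ψ, ?_, hmul, hone, fun u => ?_⟩
  · exact (continuous_unitChar n).add ((AddCircle.continuous_mk' 1).comp
      ((LinearMap.continuous_of_finiteDimensional L).comp continuous_logFR))
  · let Ψ : (𝓞 F)ˣ →* Multiplicative RmodZ :=
      (MonoidHom.mk' (fun x => Multiplicative.ofAdd (ψ x)) hmul).comp
        ((diag F).comp (unitsToField F))
    suffices u ∈ Ψ.ker from this
    have htop : (⊤ : Subgroup (𝓞 F)ˣ) ≤ Ψ.ker := by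
      rw [← closure_fundSystem_sup_torsion_eq_top, sup_le_iff, Subgroup.closure_le]
      refine ⟨?_, fun ζ hζ => ?_⟩
      · rintro _ ⟨i, rfl⟩
        change ψ (diag F (unitsToField F (fundSystem F i))) = 0
        have h1 : L (logFR (diag F (unitsToField F (fundSystem F i)))) = c i := by
          rw [← logBasis_apply, Module.Basis.constr_basis]
        have h2 : ((c i : ℝ) : RmodZ) =
          - unitChar n (diag F (unitsToField F (fundSystem F i))) := hc i
        simp only [ψ, h1, h2, add_neg_cancel]
      · have hmem : unitsToField F ζ ∈ CommGroup.torsion Fˣ :=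
          MonoidHom.isOfFinOrder (unitsToField F) hζ
        exact (hone _ (diag_mem_normOne hmem)).trans (hn _ hmem)
    exact htop trivial

theorem mem_picDom_iff {x : IdealGroup F × (FReal F)ˣ} :
    x ∈ picDom F ↔ ((FractionalIdeal.absNorm (x.1 : FractionalIdeal (𝓞 F)⁰ F) : ℚ) : ℝ) =
      ∏ w : InfinitePlace F, ‖evC w.embedding (x.2 : FReal F)‖ ^ w.mult := by
  rw [picDom, MonoidHom.mem_ker, MonoidHom.div_apply, div_eq_one, ← abs_norm_eq_prod, Units.ext_iff]
  rfl

theorem one_mem_picDom {b : (FReal F)ˣ} (hb : b ∈ normOne F) : (1, b) ∈ picDom F := by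
  rw [mem_picDom_iff]
  simp [mem_normOne.mp hb]

theorem principalHom_mem_picDom (u : Fˣ) : principalHom F u ∈ picDom F := by
  rw [mem_picDom_iff, principalHom_apply, coe_toPrincipalIdeal,
    FractionalIdeal.absNorm_span_singleton, ← prod_eq_abs_norm]
  simp [norm_embedding_eq]

/-- The class in the oriented Arakelov class group of an element of absolute value one. -/
noncomputable def normOneClass (b : normOne F) : PicTilde F :=
  PicTilde.mk F ⟨(1, b), one_mem_picDom b.2⟩

/-- A family that kills the roots of unity comes from a character of the oriented Arakelov
class group. -/
theorem exists_arTilde_eq (n : (F →+* ℂ) → ℤ)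
    (hn : ∀ u ∈ CommGroup.torsion Fˣ, unitChar n (diag F u) = 0) :
    ∃ φ : ArTilde F, ∀ b : normOne F, φ (Additive.ofMul (normOneClass b)) = unitChar n b := by
  obtain ⟨ψ, hψc, hψ, hψn, hψu⟩ := exists_char_kills_units n hn
  obtain ⟨η, hη, hηψ⟩ := exists_ideal_char ψ hψ hψu
  have hη1 : η 1 = 0 := by simpa using hη 1 1
  have : DiscreteTopology (IdealGroup F) := ⟨rfl⟩
  obtain ⟨φ, hφ⟩ := exists_continuousAddMonoidHom_quotient (principalSub F)
    (fun x => η (x : IdealGroup F × (FReal F)ˣ).1 + ψ (x : IdealGroup F × (FReal F)ˣ).2)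
    (Continuous.add
      ((continuous_of_discreteTopology (f := η)).comp (continuous_fst.comp continuous_subtype_val))
      (hψc.comp (continuous_snd.comp continuous_subtype_val)))
    (fun x y => by
      simp only [Subgroup.coe_mul, Prod.fst_mul, Prod.snd_mul, hη, hψ]
      abel)
    (fun x hx => by
      obtain ⟨α, hα⟩ := Subgroup.mem_comap.mp hx
      have hα' : (x : IdealGroup F × (FReal F)ˣ) =
        (toPrincipalIdeal (𝓞 F) F α, diag F α) := hα.symm
      rw [hα']
      exact hηψ α)
  refine ⟨φ, fun b => (hφ _).trans ?_⟩
  rw [hη1, zero_add, hψn _ b.2]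

end extension

section galois

open InfinitePlace

variable {K F : Type} [Field K] [NumberField K] [Field F] [NumberField F] [Algebra K F]

/-- The action of the Galois group on the units of `F_ℝ`. -/
noncomputable def galUnits (g : F ≃ₐ[K] F) : (FReal F)ˣ →* (FReal F)ˣ :=
  Units.map ((galFReal K g : FReal F →ₐ[ℚ] FReal F) : FReal F →* FReal F)

@[simp]
theorem evC_galUnits (g : F ≃ₐ[K] F) (τ : F →+* ℂ) (b : (FReal F)ˣ) :
    evC τ (galUnits g b : FReal F) = evC (τ.comp (g : F →+* F)) (b : FReal F) :=
  evC_galFReal g τ b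

theorem galUnits_one (b : (FReal F)ˣ) : galUnits (1 : F ≃ₐ[K] F) b = b :=
  units_ext fun w => by rw [evC_galUnits]; rfl

theorem galUnits_mul (g h : F ≃ₐ[K] F) (b : (FReal F)ˣ) :
    galUnits (g * h) b = galUnits g (galUnits h b) :=
  units_ext fun w => by rw [evC_galUnits, evC_galUnits, evC_galUnits]; rfl

theorem galUnits_mem_normOne (g : F ≃ₐ[K] F) {b : (FReal F)ˣ} (hb : b ∈ normOne F) :
    galUnits g b ∈ normOne F := fun w => by
  rw [evC_galUnits]
  exact mem_normOne'.mp hb _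

theorem galUnits_diag (g : F ≃ₐ[K] F) (u : Fˣ) :
    galUnits g (diag F u) = diag F (Units.map (g : F →* F) u) :=
  units_ext fun w => by rw [evC_galUnits, evC_diag, evC_diag]; rfl

theorem unitChar_galUnits (n : (F →+* ℂ) → ℤ) (g : F ≃ₐ[K] F) (b : (FReal F)ˣ) :
    unitChar n (galUnits g⁻¹ b) = unitChar (fun τ => n (τ.comp (g : F →+* F))) b := by
  let e : (F →+* ℂ) ≃ (F →+* ℂ) :=
    { toFun := fun τ => τ.comp (g : F →+* F)
      invFun := fun τ => τ.comp ((g⁻¹ : F ≃ₐ[K] F) : F →+* F)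
      left_inv := fun τ => by ext x; exact congrArg τ (g.apply_symm_apply x)
      right_inv := fun τ => by ext x; exact congrArg τ (g.symm_apply_apply x) }
  simp only [unitChar, evC_galUnits]
  refine (Equiv.sum_comp e _).symm.trans (Finset.sum_congr rfl fun τ _ => ?_)
  exact congrArg (fun σ => n (e τ) • argC (evC σ (b : FReal F))) (e.left_inv τ)

/-- The action of the Galois group on elements of absolute value one. -/
noncomputable def galNormOne (g : F ≃ₐ[K] F) (b : normOne F) : normOne F :=
  ⟨galUnits g b, galUnits_mem_normOne g b.2⟩

/-- The action of the Galois group on the roots of unity. -/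
noncomputable def galTorsion (g : F ≃ₐ[K] F) (u : CommGroup.torsion Fˣ) : CommGroup.torsion Fˣ :=
  ⟨Units.map (g : F →* F) u, MonoidHom.isOfFinOrder _ u.2⟩

/-- The roots of unity as elements of absolute value one. -/
noncomputable def diagTorsion (u : CommGroup.torsion Fˣ) : normOne F :=
  ⟨diag F u, diag_mem_normOne u.2⟩

theorem galNormOne_diagTorsion (g : F ≃ₐ[K] F) (u : CommGroup.torsion Fˣ) :
    galNormOne g (diagTorsion u) = diagTorsion (galTorsion g u) :=
  Subtype.ext (galUnits_diag g u)

variable {G : Type} [Group G] (iso : G ≃* (F ≃ₐ[K] F))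

theorem exists_normOne_module :
    ∃ _ : Module (MonoidAlgebra ℤ G) (normOne F → RmodZ), ∀ (g : G) (f : normOne F → RmodZ) b,
      ((MonoidAlgebra.single g (1 : ℤ) : MonoidAlgebra ℤ G) • f) b =
        f (galNormOne (iso g⁻¹) b) := by
  let : MulAction G (normOne F) :=
    { smul := fun g b => galNormOne (iso g) b
      one_smul := fun b => Subtype.ext <| by
        change galUnits (iso 1) b = b
        rw [map_one, galUnits_one]
      mul_smul := fun g h b => Subtype.ext <| by
        change galUnits (iso (g * h)) b = galUnits (iso g) (galUnits (iso h) b)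
        rw [map_mul, galUnits_mul] }
  exact exists_groupRing_module_fun (normOne F) RmodZ

omit [NumberField K] [NumberField F] in
theorem exists_torsion_module :
    ∃ _ : Module (MonoidAlgebra ℤ G) (CommGroup.torsion Fˣ → RmodZ),
      ∀ (g : G) (f : CommGroup.torsion Fˣ → RmodZ) u,
        ((MonoidAlgebra.single g (1 : ℤ) : MonoidAlgebra ℤ G) • f) u =
          f (galTorsion (iso g⁻¹) u) := by
  let : MulAction G (CommGroup.torsion Fˣ) :=
    { smul := fun g u => galTorsion (iso g) u
      one_smul := fun u => Subtype.ext <| Units.ext <| by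
        change iso 1 ((u : Fˣ) : F) = ((u : Fˣ) : F)
        rw [map_one]
        rfl
      mul_smul := fun g h u => Subtype.ext <| Units.ext <| by
        change iso (g * h) ((u : Fˣ) : F) = iso g (iso h ((u : Fˣ) : F))
        rw [map_mul]
        rfl }
  exact exists_groupRing_module_fun (CommGroup.torsion Fˣ) RmodZ

omit [NumberField K] [NumberField F] in
theorem exists_embeddings_module :
    ∃ _ : Module (MonoidAlgebra ℤ G) ((F →+* ℂ) → ℤ), ∀ (g : G) (n : (F →+* ℂ) → ℤ) τ,
      ((MonoidAlgebra.single g (1 : ℤ) : MonoidAlgebra ℤ G) • n) τ =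
        n (τ.comp (iso g : F →+* F)) := by
  let act : MulAction G (F →+* ℂ) :=
    { smul := fun g τ => τ.comp (iso g⁻¹ : F →+* F)
      one_smul := fun τ => by
        change τ.comp (iso 1⁻¹ : F →+* F) = τ
        rw [inv_one, map_one]
        rfl
      mul_smul := fun g h τ => by
        change τ.comp (iso (g * h)⁻¹ : F →+* F) =
          (τ.comp (iso h⁻¹ : F →+* F)).comp (iso g⁻¹ : F →+* F)
        rw [mul_inv_rev, map_mul]
        rfl }
  obtain ⟨m, hm⟩ := @exists_groupRing_module_fun G _ (F →+* ℂ) ℤ act _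
  refine ⟨m, fun g n τ => (hm g n τ).trans ?_⟩
  change n (τ.comp (iso g⁻¹⁻¹ : F →+* F)) = _
  rw [inv_inv]

/-- The characters of `F_ℝ` of absolute value one attached to families of integers. -/
theorem exists_unitChar_map [Module (MonoidAlgebra ℤ G) ((F →+* ℂ) → ℤ)]
    [Module (MonoidAlgebra ℤ G) (normOne F → RmodZ)]
    (hP : ∀ (g : G) (n : (F →+* ℂ) → ℤ) τ,
      ((MonoidAlgebra.single g (1 : ℤ) : MonoidAlgebra ℤ G) • n) τ =
        n (τ.comp (iso g : F →+* F)))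
    (hD : ∀ (g : G) (f : normOne F → RmodZ) b,
      ((MonoidAlgebra.single g (1 : ℤ) : MonoidAlgebra ℤ G) • f) b =
        f (galNormOne (iso g⁻¹) b)) :
    ∃ p : ((F →+* ℂ) → ℤ) →ₗ[MonoidAlgebra ℤ G] (normOne F → RmodZ),
      ∀ n b, p n b = unitChar n b := by
  refine ⟨groupRingLinearMap (AddMonoidHom.mk' (fun n b => unitChar n b) fun n m => ?_)
    fun g n => ?_, fun n b => rfl⟩
  · ext b
    exact unitChar_add n m b
  · ext b
    rw [hD]
    change unitChar _ _ = unitChar n (galUnits (iso g⁻¹) b)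
    rw [map_inv, unitChar_galUnits]
    exact congrArg (fun m => unitChar m (b : (FReal F)ˣ)) (funext (hP g n))

/-- The restriction of functions to the roots of unity. -/
theorem exists_restrict_map [Module (MonoidAlgebra ℤ G) (normOne F → RmodZ)]
    [Module (MonoidAlgebra ℤ G) (CommGroup.torsion Fˣ → RmodZ)]
    (hD : ∀ (g : G) (f : normOne F → RmodZ) b,
      ((MonoidAlgebra.single g (1 : ℤ) : MonoidAlgebra ℤ G) • f) b =
        f (galNormOne (iso g⁻¹) b))
    (hM : ∀ (g : G) (f : CommGroup.torsion Fˣ → RmodZ) u,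
      ((MonoidAlgebra.single g (1 : ℤ) : MonoidAlgebra ℤ G) • f) u =
        f (galTorsion (iso g⁻¹) u)) :
    ∃ q : (normOne F → RmodZ) →ₗ[MonoidAlgebra ℤ G] (CommGroup.torsion Fˣ → RmodZ),
      ∀ f u, q f u = f (diagTorsion u) := by
  refine ⟨groupRingLinearMap (AddMonoidHom.mk' (fun f u => f (diagTorsion u)) fun _ _ => rfl)
    fun g f => ?_, fun f u => rfl⟩
  ext u
  rw [hM]
  change ((MonoidAlgebra.single g (1 : ℤ) : MonoidAlgebra ℤ G) • f) (diagTorsion u) =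
    f (diagTorsion (galTorsion (iso g⁻¹) u))
  rw [hD, galNormOne_diagTorsion]

omit [NumberField K] [NumberField F] in
theorem exists_placeFamily_map [Module (MonoidAlgebra ℤ G) ((F →+* ℂ) → ℤ)]
    [Module (MonoidAlgebra ℤ G) (InfinitePlace F →₀ ℤ)]
    (hP : ∀ (g : G) (n : (F →+* ℂ) → ℤ) τ,
      ((MonoidAlgebra.single g (1 : ℤ) : MonoidAlgebra ℤ G) • n) τ =
        n (τ.comp (iso g : F →+* F)))
    (hS : ∀ (g : G) (x : InfinitePlace F →₀ ℤ),
      (MonoidAlgebra.single g (1 : ℤ) : MonoidAlgebra ℤ G) • x =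
        Finsupp.mapDomain (fun w => iso g • w) x) :
    ∃ j : (InfinitePlace F →₀ ℤ) →ₗ[MonoidAlgebra ℤ G] ((F →+* ℂ) → ℤ),
      ∀ x, j x = placeFamily x := by
  classical
  refine ⟨groupRingLinearMap (AddMonoidHom.mk' placeFamily fun x y => ?_) fun g x => ?_,
    fun x => rfl⟩
  · ext τ
    simp [placeFamily, mul_add]
  · ext τ
    rw [hP, hS]
    change placeFamily _ τ = placeFamily x _
    simp only [placeFamily]
    have h1 : mk τ = iso g • mk (τ.comp (iso g : F →+* F)) := by
      rw [smul_mk]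
      congr 1
      ext y
      exact congrArg τ ((iso g).apply_symm_apply y).symm
    have h2 : ComplexEmbedding.IsReal (τ.comp (iso g : F →+* F)) ↔ ComplexEmbedding.IsReal τ :=
      ComplexEmbedding.isReal_comp_iff (f := (iso g : F ≃+* F))
    rw [h1, Finsupp.mapDomain_apply (MulAction.injective (iso g))]
    simp only [h2]

theorem picDom_ext (g : F ≃ₐ[K] F) {x y z : picDom F}
    (hy : ((((y : IdealGroup F × (FReal F)ˣ).1 : FractionalIdeal (𝓞 F)⁰ F) :
      Submodule (𝓞 F) F) : Set F) =
        g '' ((((x : IdealGroup F × (FReal F)ˣ).1 : FractionalIdeal (𝓞 F)⁰ F) :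
          Submodule (𝓞 F) F) : Set F))
    (hy' : ((y : IdealGroup F × (FReal F)ˣ).2 : FReal F) =
      galFReal K g ((x : IdealGroup F × (FReal F)ˣ).2 : FReal F))
    (hz : ((((z : IdealGroup F × (FReal F)ˣ).1 : FractionalIdeal (𝓞 F)⁰ F) :
      Submodule (𝓞 F) F) : Set F) =
        g '' ((((x : IdealGroup F × (FReal F)ˣ).1 : FractionalIdeal (𝓞 F)⁰ F) :
          Submodule (𝓞 F) F) : Set F))
    (hz' : ((z : IdealGroup F × (FReal F)ˣ).2 : FReal F) =
      galFReal K g ((x : IdealGroup F × (FReal F)ˣ).2 : FReal F)) : y = z :=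
  Subtype.ext <| Prod.ext
    (Units.ext <| FractionalIdeal.coeToSubmodule_injective <| SetLike.coe_injective <|
      hy.trans hz.symm)
    (Units.ext (hy'.trans hz'.symm))

omit [NumberField K] [NumberField F] in
theorem coe_one_eq_image (g : F ≃ₐ[K] F) :
    (((1 : FractionalIdeal (𝓞 F)⁰ F) : Submodule (𝓞 F) F) : Set F) =
      g '' (((1 : FractionalIdeal (𝓞 F)⁰ F) : Submodule (𝓞 F) F) : Set F) := by
  have key : ∀ x : F, x ∈ (((1 : FractionalIdeal (𝓞 F)⁰ F) : Submodule (𝓞 F) F) : Set F) ↔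
      IsIntegral ℤ x := fun x => by
    rw [FractionalIdeal.coe_one, SetLike.mem_coe, Submodule.mem_one]
    exact ⟨fun ⟨y, hy⟩ => hy ▸ RingOfIntegers.isIntegral_coe y, fun h => ⟨⟨x, h⟩, rfl⟩⟩
  ext x
  rw [Set.mem_image, key]
  refine ⟨fun h => ⟨g.symm x, (key _).mpr ?_, g.apply_symm_apply x⟩, ?_⟩
  · exact h.map ((g.symm : F →+* F).toIntAlgHom)
  · rintro ⟨y, hy, rfl⟩
    exact ((key y).mp hy).map ((g : F →+* F).toIntAlgHom)

end galois

section duals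

variable {K F : Type} [Field K] [NumberField K] [Field F] [NumberField F] [Algebra K F]

theorem mk_mem_compImage (b : normOne F) : normOneClass b ∈ compImage F := by
  refine ⟨⟨(1, b), one_mem_picDom b.2⟩, ⟨rfl, ?_⟩, rfl⟩
  rw [SetLike.mem_coe, maxCompact_eq_normOne]
  exact b.2

theorem exists_of_mem_compImage {z : PicTilde F} (hz : z ∈ compImage F) :
    ∃ b : normOne F, z = normOneClass b := by
  obtain ⟨⟨⟨I, b⟩, hx⟩, ⟨hI, hb⟩, rfl⟩ := hz
  rw [SetLike.mem_coe, maxCompact_eq_normOne] at hb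
  obtain rfl : I = 1 := hI
  exact ⟨⟨b, hb⟩, rfl⟩

theorem normOneClass_mul (b c : normOne F) :
    normOneClass (b * c) = normOneClass b * normOneClass c :=
  congrArg (PicTilde.mk F) (Subtype.ext (Prod.ext (one_mul 1).symm rfl))

theorem normOneClass_diagTorsion (u : CommGroup.torsion Fˣ) :
    normOneClass (diagTorsion u) = 1 := by
  refine (QuotientGroup.eq_one_iff _).mpr ⟨u, ?_⟩
  rw [principalHom_apply]
  have : ∃ ζ : (𝓞 F)ˣ, unitsToField F ζ = u := by
    obtain ⟨n, hn, h⟩ := isOfFinOrder_iff_pow_eq_one.mp u.2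
    have h1 : IsIntegral ℤ ((u : Fˣ) : F) := by
      refine IsIntegral.of_pow hn ?_
      rw [← Units.val_pow_eq_pow_val, h]
      exact isIntegral_one
    have h2 : IsIntegral ℤ (((u : Fˣ)⁻¹ : Fˣ) : F) := by
      refine IsIntegral.of_pow hn ?_
      rw [← Units.val_pow_eq_pow_val, inv_pow, h, inv_one]
      exact isIntegral_one
    exact ⟨⟨⟨_, h1⟩, ⟨_, h2⟩, RingOfIntegers.ext (u : Fˣ).mul_inv,
      RingOfIntegers.ext (u : Fˣ).inv_mul⟩, Units.ext rfl⟩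
  obtain ⟨ζ, hζ⟩ := this
  rw [← hζ, toPrincipalIdeal_unitsToField, hζ]
  rfl

theorem exists_arF_eq (φ : ArTilde F)
    (h : ∀ b : normOne F, φ (Additive.ofMul (normOneClass b)) = 0) :
    ∃ ψ : ArF F, ∀ z : PicTilde F,
      ψ (Additive.ofMul (QuotientGroup.mk z : PicZero F)) = φ (Additive.ofMul z) :=
  exists_continuousAddMonoidHom_quotient (compImage F) (fun z => φ (Additive.ofMul z))
    (ContinuousAddMonoidHom.continuous_toFun φ)
    (fun x y => φ.toAddMonoidHom.map_add (Additive.ofMul x) (Additive.ofMul y))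
    fun z hz => by
      obtain ⟨b, rfl⟩ := exists_of_mem_compImage hz
      exact h b

/-- The inflation of a character of the Arakelov class group. -/
noncomputable def inflate (F : Type) [Field F] [NumberField F] : ArF F →+ ArTilde F :=
  AddMonoidHom.mk' (fun φ => ContinuousAddMonoidHom.comp φ
    ⟨MonoidHom.toAdditive (QuotientGroup.mk' (compImage F)), continuous_quotient_mk'⟩)
    fun _ _ => rfl

theorem inflate_apply (φ : ArF F) (z : PicTilde F) :
    inflate F φ (Additive.ofMul z) = φ (Additive.ofMul (QuotientGroup.mk z : PicZero F)) :=
  rfl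

theorem arTilde_ext {φ ψ : ArTilde F}
    (h : ∀ z : PicTilde F, φ (Additive.ofMul z) = ψ (Additive.ofMul z)) : φ = ψ :=
  ContinuousAddMonoidHom.ext h

theorem arF_ext {φ ψ : ArF F}
    (h : ∀ z : PicZero F, φ (Additive.ofMul z) = ψ (Additive.ofMul z)) : φ = ψ :=
  ContinuousAddMonoidHom.ext h

theorem inflate_injective : Function.Injective (inflate F) := fun φ ψ h => arF_ext fun z => by
  obtain ⟨z, rfl⟩ := QuotientGroup.mk_surjective z
  rw [← inflate_apply, ← inflate_apply, h]

variable {G : Type} [Group G] (iso : G ≃* (F ≃ₐ[K] F))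

theorem exists_evaluation_map
    (ρT : G → PicTilde F → PicTilde F)
    (hρT : ∀ (g : G) (x : picDom F), ∃ y : picDom F,
      ((((((y : IdealGroup F × (FReal F)ˣ).1 : FractionalIdeal (𝓞 F)⁰ F) :
          Submodule (𝓞 F) F) : Set F)) =
        (iso g) '' (((((x : IdealGroup F × (FReal F)ˣ).1 : FractionalIdeal (𝓞 F)⁰ F) :
          Submodule (𝓞 F) F) : Set F))) ∧
      (((y : IdealGroup F × (FReal F)ˣ).2 : FReal F) =
        galFReal K (iso g) ((x : IdealGroup F × (FReal F)ˣ).2 : FReal F)) ∧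
      ρT g (PicTilde.mk F x) = PicTilde.mk F y)
    [Module (MonoidAlgebra ℤ G) (ArTilde F)]
    (hmAT : ∀ (g : G) (φ : ArTilde F) (z : PicTilde F),
      ((MonoidAlgebra.single g (1 : ℤ) : MonoidAlgebra ℤ G) • φ) (Additive.ofMul z) =
        φ (Additive.ofMul (ρT g⁻¹ z)))
    [Module (MonoidAlgebra ℤ G) (normOne F → RmodZ)]
    (hD : ∀ (g : G) (f : normOne F → RmodZ) b,
      ((MonoidAlgebra.single g (1 : ℤ) : MonoidAlgebra ℤ G) • f) b =
        f (galNormOne (iso g⁻¹) b)) :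
    ∃ a : ArTilde F →ₗ[MonoidAlgebra ℤ G] (normOne F → RmodZ),
      ∀ φ b, a φ b = φ (Additive.ofMul (normOneClass b)) := by
  refine ⟨groupRingLinearMap (AddMonoidHom.mk'
    (fun φ b => φ (Additive.ofMul (normOneClass b))) fun _ _ => rfl) fun g φ => ?_,
    fun φ b => rfl⟩
  ext b
  rw [hD]
  refine (hmAT g φ _).trans ?_
  obtain ⟨y, hy, hy', h⟩ := hρT g⁻¹ ⟨(1, b), one_mem_picDom b.2⟩
  have hyz : y = ⟨(1, galNormOne (iso g⁻¹) b), one_mem_picDom (galNormOne (iso g⁻¹) b).2⟩ :=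
    picDom_ext (iso g⁻¹) hy hy' (coe_one_eq_image _) rfl
  change φ (Additive.ofMul (ρT g⁻¹ (PicTilde.mk F ⟨(1, b), one_mem_picDom b.2⟩))) = _
  rw [h, hyz]
  rfl

theorem exists_inflation_map
    (ρT : G → PicTilde F → PicTilde F)
    (hρT : ∀ (g : G) (x : picDom F), ∃ y : picDom F,
      ((((((y : IdealGroup F × (FReal F)ˣ).1 : FractionalIdeal (𝓞 F)⁰ F) :
          Submodule (𝓞 F) F) : Set F)) =
        (iso g) '' (((((x : IdealGroup F × (FReal F)ˣ).1 : FractionalIdeal (𝓞 F)⁰ F) :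
          Submodule (𝓞 F) F) : Set F))) ∧
      (((y : IdealGroup F × (FReal F)ˣ).2 : FReal F) =
        galFReal K (iso g) ((x : IdealGroup F × (FReal F)ˣ).2 : FReal F)) ∧
      ρT g (PicTilde.mk F x) = PicTilde.mk F y)
    [Module (MonoidAlgebra ℤ G) (ArTilde F)]
    (hmAT : ∀ (g : G) (φ : ArTilde F) (z : PicTilde F),
      ((MonoidAlgebra.single g (1 : ℤ) : MonoidAlgebra ℤ G) • φ) (Additive.ofMul z) =
        φ (Additive.ofMul (ρT g⁻¹ z)))
    (ρ0 : G → PicZero F → PicZero F)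
    (hρ0 : ∀ (g : G) (x : picDom F), ∃ y : picDom F,
      ((((((y : IdealGroup F × (FReal F)ˣ).1 : FractionalIdeal (𝓞 F)⁰ F) :
          Submodule (𝓞 F) F) : Set F)) =
        (iso g) '' (((((x : IdealGroup F × (FReal F)ˣ).1 : FractionalIdeal (𝓞 F)⁰ F) :
          Submodule (𝓞 F) F) : Set F))) ∧
      (((y : IdealGroup F × (FReal F)ˣ).2 : FReal F) =
        galFReal K (iso g) ((x : IdealGroup F × (FReal F)ˣ).2 : FReal F)) ∧
      ρ0 g (PicZero.mk F x) = PicZero.mk F y)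
    [Module (MonoidAlgebra ℤ G) (ArF F)]
    (hmAr : ∀ (g : G) (φ : ArF F) (z : PicZero F),
      ((MonoidAlgebra.single g (1 : ℤ) : MonoidAlgebra ℤ G) • φ) (Additive.ofMul z) =
        φ (Additive.ofMul (ρ0 g⁻¹ z))) :
    ∃ i : ArF F →ₗ[MonoidAlgebra ℤ G] ArTilde F, ∀ φ, i φ = inflate F φ := by
  refine ⟨groupRingLinearMap (inflate F) fun g φ => arTilde_ext fun z => ?_, fun φ => rfl⟩
  obtain ⟨x, rfl⟩ : ∃ x, PicTilde.mk F x = z := QuotientGroup.mk_surjective z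
  obtain ⟨y, hy, hy', h⟩ := hρT g⁻¹ x
  obtain ⟨y₀, hy₀, hy₀', h₀⟩ := hρ0 g⁻¹ x
  rw [hmAT, h, picDom_ext (iso g⁻¹) hy hy' hy₀ hy₀']
  exact (hmAr g φ (PicZero.mk F x)).trans (congrArg (fun t => φ (Additive.ofMul t)) h₀)

end duals

section finiteness

open InfinitePlace Units Units.dirichletUnitTheorem

variable {F : Type} [Field F] [NumberField F]

theorem PicZero.mk_mul (x y : picDom F) : PicZero.mk F (x * y) = PicZero.mk F x * PicZero.mk F y :=
  rfl

theorem PicZero.continuous_mk : Continuous (PicZero.mk F) :=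
  continuous_quotient_mk'.comp continuous_quotient_mk'

theorem PicZero.mk_principal (u : Fˣ) :
    PicZero.mk F ⟨principalHom F u, principalHom_mem_picDom u⟩ = 1 := by
  have h : PicTilde.mk F ⟨principalHom F u, principalHom_mem_picDom u⟩ = 1 :=
    (QuotientGroup.eq_one_iff _).mpr ⟨u, rfl⟩
  exact congrArg (QuotientGroup.mk (s := compImage F)) h

theorem PicZero.mk_normOne {b : (FReal F)ˣ} (hb : b ∈ normOne F) (h : (1, b) ∈ picDom F) :
    PicZero.mk F ⟨(1, b), h⟩ = 1 :=
  (QuotientGroup.eq_one_iff _).mpr (mk_mem_compImage ⟨b, hb⟩)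

theorem arF_mul (φ : ArF F) (x y : PicZero F) :
    φ (Additive.ofMul (x * y)) = φ (Additive.ofMul x) + φ (Additive.ofMul y) :=
  φ.toAddMonoidHom.map_add (Additive.ofMul x) (Additive.ofMul y)

theorem arF_one (φ : ArF F) : φ (Additive.ofMul (1 : PicZero F)) = 0 :=
  φ.toAddMonoidHom.map_zero

theorem arF_pow (φ : ArF F) (x : PicZero F) (n : ℕ) :
    φ (Additive.ofMul (x ^ n)) = n • φ (Additive.ofMul x) :=
  φ.toAddMonoidHom.map_nsmul n (Additive.ofMul x)

theorem norm_evC_units_pos (w : InfinitePlace F) (b : (FReal F)ˣ) :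
    0 < ‖evC w.embedding (b : FReal F)‖ :=
  norm_pos_iff.mpr (evC_unit_ne_zero _ _)

theorem one_mem_picDom_iff {b : (FReal F)ˣ} :
    (1, b) ∈ picDom F ↔
      ∑ w : InfinitePlace F, (w.mult : ℝ) * Real.log ‖evC w.embedding (b : FReal F)‖ = 0 := by
  have h : ∏ w : InfinitePlace F, ‖evC w.embedding (b : FReal F)‖ ^ w.mult =
      Real.exp (∑ w : InfinitePlace F, w.mult * Real.log ‖evC w.embedding (b : FReal F)‖) := by
    rw [Real.exp_sum]
    refine Finset.prod_congr rfl fun w _ => ?_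
    rw [Real.exp_nat_mul, Real.exp_log (norm_evC_units_pos w b)]
  rw [mem_picDom_iff, h, eq_comm]
  simp

/-- The real power of the absolute values of a unit of `F_ℝ`. -/
noncomputable def absPow (b : (FReal F)ˣ) (t : ℝ) : (FReal F)ˣ :=
  unitOf (fun w => (Real.exp (t * Real.log ‖evC w.embedding (b : FReal F)‖) : ℂ))
    (fun _ => Complex.ofReal_ne_zero.mpr (Real.exp_ne_zero _)) fun _ _ => Complex.conj_ofReal _

theorem evC_absPow (b : (FReal F)ˣ) (t : ℝ) (w : InfinitePlace F) :
    evC w.embedding (absPow b t : FReal F) =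
      (Real.exp (t * Real.log ‖evC w.embedding (b : FReal F)‖) : ℂ) :=
  evC_unitOf _ _ _ _

theorem log_norm_evC_absPow (b : (FReal F)ˣ) (t : ℝ) (w : InfinitePlace F) :
    Real.log ‖evC w.embedding (absPow b t : FReal F)‖ =
      t * Real.log ‖evC w.embedding (b : FReal F)‖ := by
  rw [evC_absPow, Complex.norm_real, Real.norm_of_nonneg (Real.exp_nonneg _), Real.log_exp]

theorem absPow_add (b : (FReal F)ˣ) (s t : ℝ) : absPow b (s + t) = absPow b s * absPow b t :=
  units_ext fun w => by
    rw [Units.val_mul, map_mul, evC_absPow, evC_absPow, evC_absPow, add_mul, Real.exp_add]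
    push_cast
    rfl

theorem continuous_absPow (b : (FReal F)ˣ) : Continuous (absPow b) :=
  continuous_units_iff.mpr fun w => by
    simp only [evC_absPow]
    fun_prop

theorem absPow_mem {b : (FReal F)ˣ} (hb : (1, b) ∈ picDom F) (t : ℝ) :
    (1, absPow b t) ∈ picDom F := by
  rw [one_mem_picDom_iff] at hb ⊢
  simp only [log_norm_evC_absPow, mul_left_comm _ t]
  rw [← Finset.mul_sum, hb, mul_zero]

theorem logFR_absPow (b : (FReal F)ˣ) (t : ℝ) : logFR (absPow b t) = t • logFR b := by
  ext w
  simp only [logFR, log_norm_evC_absPow, Pi.smul_apply, _root_.smul_eq_mul]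
  ring

theorem mem_normOne_of_logFR_eq_zero {b : (FReal F)ˣ} (hb : (1, b) ∈ picDom F)
    (h : logFR b = 0) : b ∈ normOne F := by
  classical
  have key : ∀ w : InfinitePlace F,
      (w.mult : ℝ) * Real.log ‖evC w.embedding (b : FReal F)‖ = 0 := by
    have h1 : ∀ w ≠ (w₀ : InfinitePlace F),
        (w.mult : ℝ) * Real.log ‖evC w.embedding (b : FReal F)‖ = 0 := fun w hw =>
      congrFun h ⟨w, hw⟩
    intro w
    rcases eq_or_ne w w₀ with rfl | hw
    · rw [one_mem_picDom_iff, Finset.sum_eq_single w₀ (fun w _ hw => h1 w hw) (by simp)] at hb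
      exact hb
    · exact h1 w hw
  intro w
  refine Real.eq_one_of_pos_of_log_eq_zero (norm_evC_units_pos w b) ?_
  exact (mul_eq_zero.mp (key w)).resolve_left (by simp [mult_ne_zero])

theorem logFR_prod {ι : Type*} (s : Finset ι) (f : ι → (FReal F)ˣ) :
    logFR (∏ i ∈ s, f i) = ∑ i ∈ s, logFR (f i) :=
  map_prod (MonoidHom.mk' (fun b : (FReal F)ˣ => Multiplicative.ofAdd (logFR b)) logFR_mul) f s

/-- The fundamental units as units of `F_ℝ`. -/
noncomputable def fundUnit (i : Fin (rank F)) : (FReal F)ˣ :=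
  diag F (unitsToField F (fundSystem F i))

theorem fundUnit_mem (i : Fin (rank F)) : (1, fundUnit i) ∈ picDom F := by
  have := principalHom_mem_picDom (unitsToField F (fundSystem F i))
  rwa [principalHom_apply, toPrincipalIdeal_unitsToField] at this

/-- The class of a real power of a fundamental unit. -/
noncomputable def fundClass (i : Fin (rank F)) (t : ℝ) : PicZero F :=
  PicZero.mk F ⟨(1, absPow (fundUnit i) t), absPow_mem (fundUnit_mem i) t⟩

theorem fundClass_add (i : Fin (rank F)) (s t : ℝ) :
    fundClass i (s + t) = fundClass i s * fundClass i t := by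
  rw [fundClass, fundClass, fundClass, ← PicZero.mk_mul]
  exact congrArg (PicZero.mk F) (Subtype.ext (Prod.ext (one_mul 1).symm (absPow_add _ s t)))

theorem continuous_fundClass (i : Fin (rank F)) : Continuous (fundClass i) :=
  PicZero.continuous_mk.comp <| Continuous.subtype_mk
    (continuous_const.prodMk (continuous_absPow (fundUnit i))) _

theorem PicZero.mk_eq_of_div_mem_normOne {I : IdealGroup F} {b c : (FReal F)ˣ}
    (hb : (I, b) ∈ picDom F) (hc : (I, c) ∈ picDom F) (h : b / c ∈ normOne F) :
    PicZero.mk F ⟨(I, b), hb⟩ = PicZero.mk F ⟨(I, c), hc⟩ := by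
  have h1 : (⟨(I, b), hb⟩ : picDom F) = ⟨(1, b / c), one_mem_picDom h⟩ * ⟨(I, c), hc⟩ :=
    Subtype.ext (Prod.ext (one_mul I).symm (div_mul_cancel b c).symm)
  rw [h1, PicZero.mk_mul, PicZero.mk_normOne h, one_mul]

theorem fundClass_one (i : Fin (rank F)) : fundClass i 1 = 1 := by
  have h1 : (1, fundUnit i) = principalHom F (unitsToField F (fundSystem F i)) := by
    rw [principalHom_apply, toPrincipalIdeal_unitsToField]
    rfl
  have h2 : PicZero.mk F ⟨(1, fundUnit i), fundUnit_mem i⟩ = 1 := by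
    simp only [h1]
    exact PicZero.mk_principal _
  rw [← h2]
  refine PicZero.mk_eq_of_div_mem_normOne _ _ fun w => ?_
  refine Real.eq_one_of_pos_of_log_eq_zero (norm_evC_units_pos w _) ?_
  rw [div_eq_mul_inv, Units.val_mul, map_mul, norm_mul, Real.log_mul
    (norm_evC_units_pos w _).ne' (norm_evC_units_pos w _).ne', log_norm_evC_absPow, evC_units_inv,
    norm_inv, Real.log_inv, one_mul, add_neg_cancel]

/-- A character trivial on the real powers of the fundamental units is trivial on all classes
with trivial ideal. -/
theorem arF_eq_zero_of_fundClass (φ : ArF F)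
    (h : ∀ i t, φ (Additive.ofMul (fundClass i t)) = 0) {b : (FReal F)ˣ} (hb : (1, b) ∈ picDom F) :
    φ (Additive.ofMul (PicZero.mk F ⟨(1, b), hb⟩)) = 0 := by
  let c : (FReal F)ˣ := ∏ i, absPow (fundUnit i) ((logBasis F).repr (logFR b) i)
  obtain ⟨hc, hφc⟩ : ∃ hc : (1, c) ∈ picDom F,
      φ (Additive.ofMul (PicZero.mk F ⟨(1, c), hc⟩)) = 0 := by
    refine Finset.prod_induction (fun i => absPow (fundUnit i) ((logBasis F).repr (logFR b) i))
      (fun c => ∃ hc : (1, c) ∈ picDom F, φ (Additive.ofMul (PicZero.mk F ⟨(1, c), hc⟩)) = 0)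
      ?_ ⟨one_mem _, arF_one φ⟩ fun i _ => ⟨absPow_mem (fundUnit_mem i) _, h i _⟩
    rintro c d ⟨hc, hc'⟩ ⟨hd, hd'⟩
    have hcd : (1, c * d) ∈ picDom F := by
      have := mul_mem hc hd
      rwa [Prod.mk_mul_mk, one_mul] at this
    refine ⟨hcd, ?_⟩
    have h1 : (⟨(1, c * d), hcd⟩ : picDom F) = ⟨(1, c), hc⟩ * ⟨(1, d), hd⟩ :=
      Subtype.ext (Prod.ext (one_mul 1).symm rfl)
    rw [h1, PicZero.mk_mul, arF_mul, hc', hd', add_zero]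
  have hlog : logFR c = logFR b := by
    rw [logFR_prod]
    simp only [logFR_absPow]
    refine Eq.trans (Finset.sum_congr rfl fun i _ => ?_) ((logBasis F).sum_repr (logFR b))
    rw [logBasis_apply, fundUnit]
  rw [PicZero.mk_eq_of_div_mem_normOne hb hc, hφc]
  refine mem_normOne_of_logFR_eq_zero ?_ ?_
  · have := div_mem hb hc
    rwa [Prod.mk_div_mk, div_one] at this
  · have := logFR_mul (b / c) c
    rw [div_mul_cancel, hlog] at this
    simpa using this

/-- The subgroup of characters trivial on all classes with trivial ideal is finite. -/
theorem finite_arF_trivial_on_units :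
    {φ : ArF F | ∀ i t, φ (Additive.ofMul (fundClass i t)) = 0}.Finite := by
  classical
  let P := (toPrincipalIdeal (𝓞 F) F).range
  have : Finite (IdealGroup F ⧸ P) := Finite.of_equiv _ (ClassGroup.equiv (R := 𝓞 F) F).toEquiv
  let n := Nat.card (IdealGroup F ⧸ P)
  have hn : 0 < n := Nat.card_pos
  let cl : picDom F → IdealGroup F ⧸ P := fun x => QuotientGroup.mk (x : IdealGroup F × (FReal F)ˣ).1
  let s : IdealGroup F ⧸ P → picDom F := Function.invFun cl
  let S : Set (IdealGroup F ⧸ P → RmodZ) := Set.univ.pi fun _ => {u : RmodZ | n • u = 0}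
  have hS : S.Finite := Set.Finite.pi fun _ => AddCircle.finite_torsion 1 hn
  have key : ∀ φ : ArF F, (∀ i t, φ (Additive.ofMul (fundClass i t)) = 0) →
      ∀ x : picDom F, cl x = 1 → φ (Additive.ofMul (PicZero.mk F x)) = 0 := by
    rintro φ hφ ⟨⟨I, b⟩, hx⟩ h
    obtain ⟨α, rfl⟩ := (QuotientGroup.eq_one_iff _).mp h
    have hb : (1, b / diag F α) ∈ picDom F := by
      have := div_mem hx (principalHom_mem_picDom α)
      rwa [principalHom_apply, Prod.mk_div_mk, div_self'] at this
    have h1 : (⟨(toPrincipalIdeal (𝓞 F) F α, b), hx⟩ : picDom F) =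
        ⟨(1, b / diag F α), hb⟩ * ⟨principalHom F α, principalHom_mem_picDom α⟩ :=
      Subtype.ext (Prod.ext (one_mul _).symm (div_mul_cancel b _).symm)
    rw [h1, PicZero.mk_mul, arF_mul, PicZero.mk_principal, arF_one,
      arF_eq_zero_of_fundClass φ hφ hb, add_zero]
  refine Set.Finite.of_finite_image (f := fun φ c => φ (Additive.ofMul (PicZero.mk F (s c))))
    (hS.subset ?_) ?_
  · rintro _ ⟨φ, hφ, rfl⟩ c -
    change n • φ (Additive.ofMul (PicZero.mk F (s c))) = 0
    rw [← arF_pow]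
    exact key φ hφ (s c ^ n) (pow_card_eq_one' (x := cl (s c)))
  · intro φ hφ ψ hψ h
    refine arF_ext fun z => ?_
    obtain ⟨z, rfl⟩ := QuotientGroup.mk_surjective z
    obtain ⟨x, rfl⟩ : ∃ x, PicTilde.mk F x = z := QuotientGroup.mk_surjective z
    have hcl : cl (s (cl x)) = cl x := Function.invFun_eq ⟨x, rfl⟩
    have h1 : cl (x / s (cl x)) = 1 := by
      change cl x / cl (s (cl x)) = 1
      rw [hcl, div_self']
    have h2 : PicZero.mk F x = PicZero.mk F (x / s (cl x)) * PicZero.mk F (s (cl x)) := by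
      rw [← PicZero.mk_mul, div_mul_cancel]
    change φ (Additive.ofMul (PicZero.mk F x)) = ψ (Additive.ofMul (PicZero.mk F x))
    rw [h2, arF_mul, arF_mul, key φ hφ _ h1, key ψ hψ _ h1]
    exact congrArg (0 + ·) (congrFun h (cl x))

theorem finite_arF : Module.Finite ℤ (ArF F) := by
  choose N hN using fun (φ : ArF F) (i : Fin (rank F)) =>
    exists_int_lift (fun t => φ (Additive.ofMul (fundClass i t)))
      ((ContinuousAddMonoidHom.continuous_toFun φ).comp (continuous_fundClass i))
      (fun s t => by rw [fundClass_add, arF_mul]) (by rw [fundClass_one, arF_one])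
  have hadd : ∀ φ ψ, N (φ + ψ) = N φ + N ψ := fun φ ψ => by
    ext i
    refine sub_eq_zero.mp (eq_zero_of_forall_zsmul_eq_zero fun x => ?_)
    obtain ⟨t, rfl⟩ := QuotientAddGroup.mk_surjective x
    have h : (φ + ψ) (Additive.ofMul (fundClass i t)) =
      φ (Additive.ofMul (fundClass i t)) + ψ (Additive.ofMul (fundClass i t)) := rfl
    rw [hN, hN, hN] at h
    rw [sub_smul, sub_eq_zero, Pi.add_apply, add_smul]
    exact h
  let f : ArF F →ₗ[ℤ] (Fin (rank F) → ℤ) := (AddMonoidHom.mk' N hadd).toIntLinearMap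
  refine ⟨Submodule.fg_of_fg_map_of_fg_inf_ker f (IsNoetherian.noetherian _) ?_⟩
  have hfin : ((⊤ ⊓ LinearMap.ker f : Submodule ℤ (ArF F)) : Set (ArF F)).Finite := by
    refine finite_arF_trivial_on_units.subset fun φ hφ i t => ?_
    have h : N φ i = 0 := congrFun hφ.2 i
    rw [hN, h, zero_smul]
  have : Finite (⊤ ⊓ LinearMap.ker f : Submodule ℤ (ArF F)) := hfin
  exact Module.Finite.iff_fg.mp Module.Finite.of_finite

end finiteness

section rootsOfUnity

/-- The inclusion of `ℚ/ℤ` into `ℝ/ℤ`. -/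
noncomputable def qmodZToRmodZ : QmodZ →ₗ[ℤ] RmodZ :=
  Submodule.liftQ _ ((QuotientAddGroup.mk' (AddSubgroup.zmultiples (1 : ℝ))).comp
    (Rat.castHom ℝ).toAddMonoidHom).toIntLinearMap <| by
      rw [Submodule.span_singleton_le_iff_mem, LinearMap.mem_ker]
      exact (QuotientAddGroup.eq_zero_iff _).mpr ⟨1, by simp⟩

theorem qmodZToRmodZ_mk (x : ℚ) :
    qmodZToRmodZ (Submodule.Quotient.mk x) = ((x : ℝ) : RmodZ) :=
  rfl

theorem qmodZToRmodZ_injective : Function.Injective qmodZToRmodZ := by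
  rw [injective_iff_map_eq_zero]
  intro x hx
  obtain ⟨x, rfl⟩ := Submodule.Quotient.mk_surjective _ x
  rw [qmodZToRmodZ_mk, AddCircle.coe_eq_zero_iff] at hx
  obtain ⟨n, hn⟩ := hx
  rw [Submodule.Quotient.mk_eq_zero, Submodule.mem_span_singleton]
  refine ⟨n, ?_⟩
  rw [zsmul_one] at hn ⊢
  exact_mod_cast hn

theorem exists_qmodZToRmodZ_eq {m : ℕ} (hm : m ≠ 0) {x : RmodZ} (hx : m • x = 0) :
    ∃ y, qmodZToRmodZ y = x := by
  obtain ⟨r, rfl⟩ := QuotientAddGroup.mk_surjective x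
  change ((m • r : ℝ) : RmodZ) = 0 at hx
  rw [AddCircle.coe_eq_zero_iff] at hx
  obtain ⟨n, hn⟩ := hx
  refine ⟨Submodule.Quotient.mk (n / m), ?_⟩
  rw [qmodZToRmodZ_mk]
  refine congrArg _ ?_
  rw [zsmul_one, nsmul_eq_mul] at hn
  push_cast
  rw [hn]
  exact mul_div_cancel_left₀ r (Nat.cast_ne_zero.mpr hm)

theorem argC_pow {z : ℂ} (hz : ‖z‖ = 1) (n : ℕ) : argC (z ^ n) = n • argC z := by
  induction n with
  | zero => rw [pow_zero, argC_one, zero_smul]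
  | succ k ih =>
    have h0 : z ≠ 0 := norm_ne_zero_iff.mp (hz ▸ one_ne_zero)
    rw [pow_succ, argC_mul (pow_ne_zero k h0) h0, ih, succ_nsmul]

variable {F : Type} [Field F] [NumberField F]

/-- The value of `unitChar n` at roots of unity, as a homomorphism. -/
noncomputable def torsionChar (n : (F →+* ℂ) → ℤ) :
    Additive (CommGroup.torsion Fˣ) →+ RmodZ :=
  AddMonoidHom.mk' (fun u => unitChar n (diagTorsion u.toMul)) fun u v => by
    refine Eq.trans (congrArg (unitChar n) (map_mul (diag F) _ _)) ?_
    exact unitChar_mul n (diagTorsion u.toMul) (diagTorsion v.toMul)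

theorem continuous_normOneClass : Continuous (normOneClass (F := F)) :=
  continuous_quotient_mk'.comp <| Continuous.subtype_mk
    (continuous_const.prodMk continuous_subtype_val) _

theorem finite_torsion_units : Finite (CommGroup.torsion Fˣ) := by
  have : Finite {x : F | IsIntegral ℤ x ∧ ∀ φ : F →+* ℂ, ‖φ x‖ ≤ 1} :=
    (Embeddings.finite_of_norm_le F ℂ 1).to_subtype
  let f (u : CommGroup.torsion Fˣ) : {x : F | IsIntegral ℤ x ∧ ∀ φ : F →+* ℂ, ‖φ x‖ ≤ 1} :=
    ⟨((u : Fˣ) : F), ?_, fun φ => ?_⟩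
  · exact Finite.of_injective f fun u v h => Subtype.ext (Units.ext (congrArg Subtype.val h))
  · obtain ⟨m, hm, h⟩ := isOfFinOrder_iff_pow_eq_one.mp u.2
    exact IsIntegral.of_pow hm (by rw [← Units.val_pow_eq_pow_val, h]; exact isIntegral_one)
  · obtain ⟨m, hm, h⟩ := isOfFinOrder_iff_pow_eq_one.mp u.2
    refine (Complex.norm_eq_one_of_pow_eq_one ?_ hm.ne').le
    rw [← map_pow, ← Units.val_pow_eq_pow_val, h, Units.val_one, map_one]

theorem exists_torsion_hom (n : (F →+* ℂ) → ℤ) :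
    ∃ f : Additive (CommGroup.torsion Fˣ) →ₗ[ℤ] QmodZ,
      ∀ u, qmodZToRmodZ (f u) = torsionChar n u := by
  have h : ∀ u, ∃ y, qmodZToRmodZ y = torsionChar n u := fun u => by
    obtain ⟨m, hm, h⟩ := (isOfFinOrder_iff_pow_eq_one.mp u.toMul.2 :)
    refine exists_qmodZToRmodZ_eq hm.ne' ?_
    rw [← map_nsmul]
    refine (congrArg (torsionChar n) ?_).trans (map_zero _)
    exact Subtype.ext h
  choose f hf using h
  refine ⟨(AddMonoidHom.mk' f fun u v => qmodZToRmodZ_injective ?_).toIntLinearMap, hf⟩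
  rw [map_add, hf, hf, hf, map_add]

theorem exists_torsionChar_eq (f : Additive (CommGroup.torsion Fˣ) →ₗ[ℤ] QmodZ) :
    ∃ n : (F →+* ℂ) → ℤ, ∀ u, torsionChar n u = qmodZToRmodZ (f u) := by
  classical
  have := finite_torsion_units (F := F)
  obtain ⟨τ⟩ : Nonempty (F →+* ℂ) := inferInstance
  have hcyc : IsCyclic (CommGroup.torsion Fˣ) :=
    isCyclic_of_injective_ringHom ((Units.coeHom F).comp (CommGroup.torsion Fˣ).subtype)
      fun u v h => Subtype.ext (Units.ext h)
  obtain ⟨ζ, hζ⟩ := IsCyclic.exists_generator (α := CommGroup.torsion Fˣ)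
  let m := orderOf ζ
  have hm : m ≠ 0 := (orderOf_pos ζ).ne'
  have : NeZero m := ⟨hm⟩
  have hprim : IsPrimitiveRoot (τ ((ζ : Fˣ) : F)) m := by
    refine IsPrimitiveRoot.map_of_injective (f := τ) ?_ τ.injective
    rw [IsPrimitiveRoot.coe_units_iff, IsPrimitiveRoot.coe_submonoidClass_iff (M := Fˣ)]
    exact IsPrimitiveRoot.orderOf ζ
  have hnorm : ‖τ ((ζ : Fˣ) : F)‖ = 1 := hprim.norm'_eq_one hm
  obtain ⟨z, hz, hzf⟩ := exists_norm_eq_one_argC_eq (qmodZToRmodZ (f (Additive.ofMul ζ)))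
  have hzm : z ^ m = 1 := by
    refine argC_inj (by rw [norm_pow, hz, one_pow]) norm_one ?_
    rw [argC_pow hz, hzf, argC_one, ← map_nsmul, ← map_nsmul, ← ofMul_pow, pow_orderOf_eq_one,
      ofMul_one, map_zero, map_zero]
  obtain ⟨k, -, hk⟩ := hprim.eq_pow_of_pow_eq_one hzm
  refine ⟨Pi.single τ k, ?_⟩
  have key : torsionChar (Pi.single τ (k : ℤ)) (Additive.ofMul ζ) =
      qmodZToRmodZ (f (Additive.ofMul ζ)) := by
    change ∑ σ, (Pi.single τ (k : ℤ) : (F →+* ℂ) → ℤ) σ • argC (evC σ (diag F ζ : FReal F)) = _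
    rw [Finset.sum_eq_single τ (fun σ _ h => by rw [Pi.single_eq_of_ne h, zero_smul])
      (fun h => absurd (Finset.mem_univ τ) h), Pi.single_eq_same, evC_diag, natCast_zsmul,
      ← argC_pow hnorm, hk, hzf]
  intro u
  obtain ⟨l, hl⟩ := hζ u.toMul
  have hu : u = l • Additive.ofMul ζ := hl.symm
  rw [hu, map_zsmul, key, map_zsmul, map_zsmul]

variable {K G : Type} [Field K] [NumberField K] [Algebra K F] [Group G] (iso : G ≃* (F ≃ₐ[K] F))

omit [NumberField F] [NumberField K] in
theorem exists_dual_torsion_map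
    [Module (MonoidAlgebra ℤ G) (Additive (CommGroup.torsion Fˣ))]
    (hmMu : ∀ (g : G) (u v : CommGroup.torsion Fˣ), ((v : Fˣ) : F) = iso g ((u : Fˣ) : F) →
      (MonoidAlgebra.single g (1 : ℤ) : MonoidAlgebra ℤ G) • Additive.ofMul u =
        Additive.ofMul v)
    [Module (MonoidAlgebra ℤ G) (Additive (CommGroup.torsion Fˣ) →ₗ[ℤ] QmodZ)]
    (hQ : ∀ (g : G) (f : Additive (CommGroup.torsion Fˣ) →ₗ[ℤ] QmodZ) x,
      ((MonoidAlgebra.single g (1 : ℤ) : MonoidAlgebra ℤ G) • f) x =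
        f ((MonoidAlgebra.single g⁻¹ (1 : ℤ) : MonoidAlgebra ℤ G) • x))
    [Module (MonoidAlgebra ℤ G) (CommGroup.torsion Fˣ → RmodZ)]
    (hM : ∀ (g : G) (f : CommGroup.torsion Fˣ → RmodZ) u,
      ((MonoidAlgebra.single g (1 : ℤ) : MonoidAlgebra ℤ G) • f) u =
        f (galTorsion (iso g⁻¹) u)) :
    ∃ e : (Additive (CommGroup.torsion Fˣ) →ₗ[ℤ] QmodZ) →ₗ[MonoidAlgebra ℤ G]
        (CommGroup.torsion Fˣ → RmodZ),
      ∀ f u, e f u = qmodZToRmodZ (f (Additive.ofMul u)) := by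
  refine ⟨groupRingLinearMap (AddMonoidHom.mk'
    (fun f u => qmodZToRmodZ (f (Additive.ofMul u))) fun f f' => ?_) fun g f => ?_,
    fun f u => rfl⟩
  · ext u
    exact map_add qmodZToRmodZ _ _
  · ext u
    rw [hM]
    change qmodZToRmodZ _ = qmodZToRmodZ _
    rw [hQ, hmMu g⁻¹ u (galTorsion (iso g⁻¹) u) rfl]

end rootsOfUnity

/-!
STATEMENT 14: Let F/K be a finite Galois extension of number fields with Galois group G,
let d be the degree of K over ℚ, let S∞ be the set of archimedean places of F, and let
μ_F be the group of roots of unity of F.  Then the equality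
[Ãr_F] − [Ar_F] = d·[ℤ[G]] − [ℤ[S∞]] + σ[μ_F] holds in G₀(ℤ[G]).

`Ãr_F` and `Ar_F` are the Pontryagin duals of the oriented Arakelov class group and of
the Arakelov class group constructed above, with ℤ[G]-module structures (via g ↦ g⁻¹)
universally quantified and pinned down pointwise; σ is characterized by its effect on
lattices and on finite modules.
-/
theorem stmt14
    (K F : Type) [Field K] [NumberField K] [Field F] [NumberField F] [Algebra K F]
    [IsGalois K F] (G : Type) [Group G] (iso : G ≃* (F ≃ₐ[K] F))
    -- the Galois action of G on the oriented Arakelov class group, characterized on classes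
    -- of oriented Arakelov divisors (I, b) via the action on the underlying ideals and on F_ℝ
    (ρT : G → PicTilde F → PicTilde F)
    (hρT : ∀ (g : G) (x : picDom F), ∃ y : picDom F,
      ((((((y : IdealGroup F × (FReal F)ˣ).1 : FractionalIdeal (𝓞 F)⁰ F) :
          Submodule (𝓞 F) F) : Set F)) =
        (iso g) '' (((((x : IdealGroup F × (FReal F)ˣ).1 : FractionalIdeal (𝓞 F)⁰ F) :
          Submodule (𝓞 F) F) : Set F))) ∧
      (((y : IdealGroup F × (FReal F)ˣ).2 : FReal F) =
        galFReal K (iso g) ((x : IdealGroup F × (FReal F)ˣ).2 : FReal F)) ∧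
      ρT g (PicTilde.mk F x) = PicTilde.mk F y)
    -- the ℤ[G]-module structure on the Pontryagin dual (G acting via g ↦ g⁻¹)
    [mAT : Module (MonoidAlgebra ℤ G) (ArTilde F)]
    (hmAT : ∀ (g : G) (φ : ArTilde F) (z : PicTilde F),
      ((MonoidAlgebra.single g (1 : ℤ) : MonoidAlgebra ℤ G) • φ) (Additive.ofMul z) =
        φ (Additive.ofMul (ρT g⁻¹ z)))
    -- the Galois action of G on the Arakelov class group, characterized on classes
    -- of oriented Arakelov divisors (I, b) via the action on the underlying ideals and on F_ℝ
    (ρ0 : G → PicZero F → PicZero F)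
    (hρ0 : ∀ (g : G) (x : picDom F), ∃ y : picDom F,
      ((((((y : IdealGroup F × (FReal F)ˣ).1 : FractionalIdeal (𝓞 F)⁰ F) :
          Submodule (𝓞 F) F) : Set F)) =
        (iso g) '' (((((x : IdealGroup F × (FReal F)ˣ).1 : FractionalIdeal (𝓞 F)⁰ F) :
          Submodule (𝓞 F) F) : Set F))) ∧
      (((y : IdealGroup F × (FReal F)ˣ).2 : FReal F) =
        galFReal K (iso g) ((x : IdealGroup F × (FReal F)ˣ).2 : FReal F)) ∧
      ρ0 g (PicZero.mk F x) = PicZero.mk F y)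
    -- the ℤ[G]-module structure on the Pontryagin dual (G acting via g ↦ g⁻¹)
    [mAr : Module (MonoidAlgebra ℤ G) (ArF F)]
    (hmAr : ∀ (g : G) (φ : ArF F) (z : PicZero F),
      ((MonoidAlgebra.single g (1 : ℤ) : MonoidAlgebra ℤ G) • φ) (Additive.ofMul z) =
        φ (Additive.ofMul (ρ0 g⁻¹ z)))
    -- the permutation ℤ[G]-module ℤ[S∞] on the set of archimedean places of F
    [mS : Module (MonoidAlgebra ℤ G) (NumberField.InfinitePlace F →₀ ℤ)]
    (hmS : ∀ (g : G) (x : NumberField.InfinitePlace F →₀ ℤ),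
      (MonoidAlgebra.single g (1 : ℤ) : MonoidAlgebra ℤ G) • x =
        Finsupp.mapDomain (fun w => iso g • w) x)
    -- the ℤ[G]-module μ_F of roots of unity of F
    [mMu : Module (MonoidAlgebra ℤ G) (Additive (CommGroup.torsion Fˣ))]
    (hmMu : ∀ (g : G) (u v : CommGroup.torsion Fˣ), ((v : Fˣ) : F) = iso g ((u : Fˣ) : F) →
      (MonoidAlgebra.single g (1 : ℤ) : MonoidAlgebra ℤ G) • Additive.ofMul u =
        Additive.ofMul v)
    -- σ : the duality endomorphism of G₀(ℤ[G]) induced by M ↦ Hom_ℤ(M,ℤ) on lattices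
    -- (with G acting via the involution g ↦ g⁻¹); on a finite module N it satisfies
    -- σ[N] = −[Hom_ℤ(N, ℚ/ℤ)]
    (σ : G0 (MonoidAlgebra ℤ G) →+ G0 (MonoidAlgebra ℤ G))
    (hσlat : ∀ (M : Type) [AddCommGroup M] [Module (MonoidAlgebra ℤ G) M]
        [Module.Finite (MonoidAlgebra ℤ G) M] [Module.Projective ℤ M]
        [Module (MonoidAlgebra ℤ G) (M →ₗ[ℤ] ℤ)],
      (∀ (g : G) (φ : M →ₗ[ℤ] ℤ) (x : M),
        ((MonoidAlgebra.single g (1 : ℤ) : MonoidAlgebra ℤ G) • φ) x =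
          φ ((MonoidAlgebra.single g⁻¹ (1 : ℤ) : MonoidAlgebra ℤ G) • x)) →
      σ (G0.cls (MonoidAlgebra ℤ G) M) = G0.cls (MonoidAlgebra ℤ G) (M →ₗ[ℤ] ℤ))
    (hσtor : ∀ (N : Type) [AddCommGroup N] [Module (MonoidAlgebra ℤ G) N]
        [Module (MonoidAlgebra ℤ G) (N →ₗ[ℤ] QmodZ)], Finite N →
      (∀ (g : G) (φ : N →ₗ[ℤ] QmodZ) (x : N),
        ((MonoidAlgebra.single g (1 : ℤ) : MonoidAlgebra ℤ G) • φ) x =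
          φ ((MonoidAlgebra.single g⁻¹ (1 : ℤ) : MonoidAlgebra ℤ G) • x)) →
      σ (G0.cls (MonoidAlgebra ℤ G) N) = - G0.cls (MonoidAlgebra ℤ G) (N →ₗ[ℤ] QmodZ))
 :
    G0.cls (MonoidAlgebra ℤ G) (ArTilde F) - G0.cls (MonoidAlgebra ℤ G) (ArF F) =
      (Module.finrank ℚ K) • G0.cls (MonoidAlgebra ℤ G) (MonoidAlgebra ℤ G) -
        G0.cls (MonoidAlgebra ℤ G) (NumberField.InfinitePlace F →₀ ℤ) +
        σ (G0.cls (MonoidAlgebra ℤ G) (Additive (CommGroup.torsion Fˣ))) := by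
  obtain ⟨mD, hD⟩ := exists_normOne_module iso
  obtain ⟨mM, hM⟩ := exists_torsion_module iso
  obtain ⟨mP, hP⟩ := exists_embeddings_module iso
  obtain ⟨mQ, hQ⟩ := exists_groupRing_module_hom (G := G) (Additive (CommGroup.torsion Fˣ)) QmodZ
  obtain ⟨p, hp⟩ := exists_unitChar_map iso hP hD
  obtain ⟨q, hq⟩ := exists_restrict_map iso hD hM
  obtain ⟨j, hj⟩ := exists_placeFamily_map iso hP hmS
  obtain ⟨a, ha⟩ := exists_evaluation_map iso ρT hρT hmAT hD
  obtain ⟨i, hi⟩ := exists_inflation_map iso ρT hρT hmAT ρ0 hρ0 hmAr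
  obtain ⟨e, he⟩ := exists_dual_torsion_map iso hmMu hQ hM
  have : FiniteDimensional K F := Module.Finite.of_restrictScalars_finite ℚ K F
  have : Finite G := Finite.of_equiv _ iso.symm.toEquiv
  have : IsNoetherianRing (MonoidAlgebra ℤ G) := IsNoetherianRing.of_finite ℤ _
  have := finite_arF (F := F)
  have : Module.Finite (MonoidAlgebra ℤ G) (ArF F) := Module.Finite.of_restrictScalars_finite ℤ _ _
  have : Module.Finite (MonoidAlgebra ℤ G) ((F →+* ℂ) → ℤ) :=
    Module.Finite.of_restrictScalars_finite ℤ _ _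
  have hqp : ∀ n u, q (p n) u = torsionChar n (Additive.ofMul u) := fun n u => by
    rw [hq, hp]
    rfl
  have : Finite (Additive (CommGroup.torsion Fˣ)) := finite_torsion_units
  rw [hσtor (Additive (CommGroup.torsion Fˣ)) this hQ, ← sub_eq_add_neg,
    ← cls_embeddings iso hP]
  refine G0.cls_sub_cls_of_exact i a j p q e ?_ (fun φ => ⟨fun h => ?_, ?_⟩) ?_
    (fun n => ⟨fun h => ?_, ?_⟩) (fun φ => ?_) (fun φ => ?_) (fun n h => ?_)
    (fun f f' h => ?_) (fun n => ?_) fun f => ?_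
  · exact fun φ ψ h => inflate_injective (by rwa [hi, hi] at h)
  · obtain ⟨ψ, hψ⟩ := exists_arF_eq φ fun b => by rw [← ha, h, Pi.zero_apply]
    exact ⟨ψ, (hi ψ).trans (arTilde_ext hψ)⟩
  · rintro ⟨ψ, rfl⟩
    ext b
    rw [ha, hi, inflate_apply]
    exact (congrArg (fun z => ψ (Additive.ofMul z))
      ((QuotientGroup.eq_one_iff _).mpr (mk_mem_compImage b))).trans (arF_one ψ)
  · exact fun x y h => placeFamily_injective (by rwa [hj, hj] at h)
  · obtain ⟨x, hx⟩ := (exists_placeFamily_iff n).mpr fun b hb => by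
      rw [← hp n ⟨b, hb⟩, h, Pi.zero_apply]
    exact ⟨x, (hj x).trans hx⟩
  · rintro ⟨x, rfl⟩
    ext b
    rw [hp, hj]
    exact (exists_placeFamily_iff _).mp ⟨x, rfl⟩ b b.2
  · obtain ⟨n, hn⟩ := exists_unitChar_eq (fun b => φ (Additive.ofMul (normOneClass b)))
      ((ContinuousAddMonoidHom.continuous_toFun φ).comp continuous_normOneClass) fun b c => by
        rw [normOneClass_mul]
        exact φ.toAddMonoidHom.map_add _ _
    exact ⟨n, funext fun b => by rw [hp, ha, ← hn]⟩
  · ext u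
    rw [hq, ha, normOneClass_diagTorsion]
    exact φ.toAddMonoidHom.map_zero
  · obtain ⟨φ, hφ⟩ := exists_arTilde_eq n fun u hu => by
      have := congrFun h ⟨u, hu⟩
      rwa [hq, hp] at this
    exact ⟨φ, funext fun b => by rw [ha, hφ, hp]⟩
  · refine LinearMap.ext fun u => ?_
    have h1 := congrFun h u.toMul
    rw [he, he] at h1
    exact qmodZToRmodZ_injective h1
  · obtain ⟨f, hf⟩ := exists_torsion_hom n
    exact ⟨f, funext fun u => by rw [he, hf, hqp]⟩
  · obtain ⟨n, hn⟩ := exists_torsionChar_eq f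
    exact ⟨n, funext fun u => by rw [he, hqp, hn]⟩
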